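/- The 27-hyperplane arrangement A in ℚ(ζ)³ is free but not recursively free. -/

import Mathlib

open Module Matrix
open scoped Classical

namespace Arrgt

variable {K : Type*} [Field K]

/-- A (central) hyperplane arrangement in `K^n`: a finite set of kernels of
nonzero linear forms. -/
structure Arrangement (K : Type*) [Field K] (n : ℕ) where
  hyperplanes : Finset (Submodule K (Fin n → K))
  isHyp : ∀ H ∈ hyperplanes, ∃ f : (Fin n → K) →ₗ[K] K, f ≠ 0 ∧ H = LinearMap.ker f

/-- The deletion `A \ {H}`. -/
noncomputable def Arrangement.delete {n : ℕ} (A : Arrangement K n) (H : Submodule K (Fin n → K)) :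
    Arrangement K n :=
  ⟨A.hyperplanes.erase H, fun H' hH' => A.isHyp H' (Finset.mem_of_mem_erase hH')⟩

/-- The empty arrangement of rank `n`. -/
def emptyArr (K : Type*) [Field K] (n : ℕ) : Arrangement K n := ⟨∅, by simp⟩

/-- The linear polynomial in `K[x_1,...,x_n]` attached to a linear form. -/
noncomputable def linPoly {n : ℕ} (f : (Fin n → K) →ₗ[K] K) : MvPolynomial (Fin n) K :=
  ∑ i, MvPolynomial.C (f (Pi.single i 1)) * MvPolynomial.X i

/-- `Q` is a defining polynomial of the arrangement `A`: a product of linear forms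
whose kernels are exactly the hyperplanes of `A`. -/
def IsDefiningPoly {n : ℕ} (A : Arrangement K n) (Q : MvPolynomial (Fin n) K) : Prop :=
  ∃ α : Submodule K (Fin n → K) → ((Fin n → K) →ₗ[K] K),
    (∀ H ∈ A.hyperplanes, α H ≠ 0 ∧ LinearMap.ker (α H) = H) ∧
    Q = ∏ H ∈ A.hyperplanes, linPoly (α H)

/-- Evaluation of a derivation at the polynomial `Q`, as a linear map. -/
noncomputable def evalDer {n : ℕ} (Q : MvPolynomial (Fin n) K) :
    Derivation K (MvPolynomial (Fin n) K) (MvPolynomial (Fin n) K) →ₗ[MvPolynomial (Fin n) K]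
      MvPolynomial (Fin n) K where
  toFun θ := θ Q
  map_add' _ _ := rfl
  map_smul' _ _ := rfl

/-- The module `D(A) = {θ : θ(Q) ∈ Q·S}` of `A`-derivations (for a chosen defining
polynomial `Q`). -/
noncomputable def DerModule {n : ℕ} (Q : MvPolynomial (Fin n) K) :
    Submodule (MvPolynomial (Fin n) K)
      (Derivation K (MvPolynomial (Fin n) K) (MvPolynomial (Fin n) K)) :=
  Submodule.comap (evalDer Q) (Ideal.span {Q})

/-- `A` is a free arrangement: `D(A)` is a free module over `S = K[x_1,...,x_n]`. -/
def IsFree {n : ℕ} (A : Arrangement K n) : Prop :=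
  ∃ Q, IsDefiningPoly A Q ∧ Module.Free (MvPolynomial (Fin n) K) (DerModule Q)

/-- A nonzero derivation is homogeneous of polynomial degree `p` if all its
coefficients are homogeneous of degree `p`. -/
def IsHomogeneousDer {n : ℕ}
    (θ : Derivation K (MvPolynomial (Fin n) K) (MvPolynomial (Fin n) K)) (p : ℕ) : Prop :=
  θ ≠ 0 ∧ ∀ i, (θ (MvPolynomial.X i)).IsHomogeneous p

/-- `A` is free with exponents the multiset `e`: `D(A)` has a homogeneous basis whose
polynomial degrees form the multiset `e`. -/
def HasExponents {n : ℕ} (A : Arrangement K n) (e : Multiset ℕ) : Prop :=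
  ∃ Q, IsDefiningPoly A Q ∧
    ∃ (l : List ℕ) (b : Basis (Fin l.length) (MvPolynomial (Fin n) K) (DerModule Q)),
      (l : Multiset ℕ) = e ∧ ∀ i : Fin l.length, IsHomogeneousDer ((b i : DerModule Q) :
        Derivation K (MvPolynomial (Fin n) K) (MvPolynomial (Fin n) K)) (l.get i)

/-- `B` is (a model, via a linear identification `H ≅ K^n`, of) the restriction `A^H`. -/
def IsRestriction {n : ℕ} (A : Arrangement K (n + 1)) (H : Submodule K (Fin (n + 1) → K))
    (B : Arrangement K n) : Prop :=
  ∃ e : H ≃ₗ[K] (Fin n → K),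
    B.hyperplanes = (A.hyperplanes.erase H).image
      (fun H' => Submodule.map (e : H →ₗ[K] (Fin n → K)) (H'.comap H.subtype))

variable (K) in
/-- The class of inductively free arrangements. -/
inductive InductivelyFree : {n : ℕ} → Arrangement K n → Prop
  | empty (n : ℕ) : InductivelyFree (emptyArr K n)
  | add {n : ℕ} (A : Arrangement K (n + 1)) (H : Submodule K (Fin (n + 1) → K))
      (hH : H ∈ A.hyperplanes) (B : Arrangement K n) (hB : IsRestriction A H B)
      (e' e'' : Multiset ℕ)
      (h1 : InductivelyFree (A.delete H)) (h2 : InductivelyFree B)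
      (h3 : HasExponents (A.delete H) e') (h4 : HasExponents B e'')
      (h5 : e'' ≤ e') : InductivelyFree A

variable (K) in
/-- The class of recursively free arrangements. -/
inductive RecursivelyFree : {n : ℕ} → Arrangement K n → Prop
  | empty (n : ℕ) : RecursivelyFree (emptyArr K n)
  | add {n : ℕ} (A : Arrangement K (n + 1)) (H : Submodule K (Fin (n + 1) → K))
      (hH : H ∈ A.hyperplanes) (B : Arrangement K n) (hB : IsRestriction A H B)
      (e' e'' : Multiset ℕ)
      (h1 : RecursivelyFree (A.delete H)) (h2 : RecursivelyFree B)
      (h3 : HasExponents (A.delete H) e') (h4 : HasExponents B e'')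
      (h5 : e'' ≤ e') : RecursivelyFree A
  | del {n : ℕ} (A : Arrangement K (n + 1)) (H : Submodule K (Fin (n + 1) → K))
      (hH : H ∈ A.hyperplanes) (B : Arrangement K n) (hB : IsRestriction A H B)
      (e e'' : Multiset ℕ)
      (h1 : RecursivelyFree A) (h2 : RecursivelyFree B)
      (h3 : HasExponents A e) (h4 : HasExponents B e'')
      (h5 : e'' ≤ e) : RecursivelyFree (A.delete H)

/-- The intersection lattice of a set of hyperplanes: all intersections of finite
subsets (including the ambient space `⊤` as the empty intersection). -/
def setLattice {n : ℕ} (𝓐 : Set (Submodule K (Fin n → K))) : Set (Submodule K (Fin n → K)) :=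
  {X | ∃ s : Finset (Submodule K (Fin n → K)), ↑s ⊆ 𝓐 ∧ X = s.inf id}

/-- The intersection lattice of an arrangement. -/
def Arrangement.lattice {n : ℕ} (A : Arrangement K n) : Set (Submodule K (Fin n → K)) :=
  setLattice (↑A.hyperplanes)

/-- The linear form `x ↦ ∑ v i * x i` attached to a normal vector `v`. -/
noncomputable def lf {n : ℕ} (v : Fin n → K) : (Fin n → K) →ₗ[K] K :=
  ∑ i, v i • LinearMap.proj i

lemma lf_single {n : ℕ} (v : Fin n → K) (j : Fin n) : lf v (Pi.single j 1) = v j := by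
  simp [lf, Pi.single_apply, mul_ite, Finset.sum_ite_eq']

lemma lf_ne_zero {n : ℕ} {v : Fin n → K} (hv : v ≠ 0) : lf v ≠ 0 := by
  intro h
  apply hv
  funext j
  have := congrArg (fun f : (Fin n → K) →ₗ[K] K => f (Pi.single j 1)) h
  simpa [lf_single] using this

/-- The hyperplane `v^⊥` with normal vector `v`. -/
noncomputable def perp {n : ℕ} (v : Fin n → K) : Submodule K (Fin n → K) :=
  LinearMap.ker (lf v)

/-- Build an arrangement from a finite set of nonzero normal vectors. -/
noncomputable def mkArr {n : ℕ} (vs : Finset (Fin n → K)) (h : (0 : Fin n → K) ∉ vs) :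
    Arrangement K n :=
  ⟨vs.image perp, by
    intro H hH
    obtain ⟨v, hv, rfl⟩ := Finset.mem_image.mp hH
    exact ⟨lf v, lf_ne_zero (fun h0 => h (h0 ▸ hv)), rfl⟩⟩

end Arrgt

namespace Arrgt

open MvPolynomial

section Generic

variable {K : Type*} [Field K] {n : ℕ}

/-- The module of polynomial derivations of `K[x_1,...,x_n]`. -/
abbrev Der (K : Type*) [Field K] (n : ℕ) : Type _ :=
  Derivation K (MvPolynomial (Fin n) K) (MvPolynomial (Fin n) K)

/-- The polynomial vector field on `K^n` attached to a derivation. -/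
noncomputable def vf (θ : Der K n) (x : Fin n → K) : Fin n → K :=
  fun i => eval x (θ (X i))

/-- A derivation is tangent to every hyperplane of `A`, seen as a vector field. -/
def Tangent (A : Arrangement K n) (θ : Der K n) : Prop :=
  ∀ H ∈ A.hyperplanes, ∀ x ∈ H, vf θ x ∈ H

lemma linearForm_apply (f : (Fin n → K) →ₗ[K] K) (x : Fin n → K) :
    f x = ∑ i, f (Pi.single i 1) * x i := by
  conv_lhs => rw [← Finset.univ_sum_single x, map_sum]
  refine Finset.sum_congr rfl fun i _ => ?_
  have : (Pi.single i (x i) : Fin n → K) = x i • Pi.single i 1 := by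
    rw [← Pi.single_smul, smul_eq_mul, mul_one]
  rw [this, map_smul, smul_eq_mul, mul_comm]

lemma eval_linPoly (f : (Fin n → K) →ₗ[K] K) (x : Fin n → K) : eval x (linPoly f) = f x := by
  simp [linPoly, linearForm_apply f x]

lemma linPoly_isHomogeneous (f : (Fin n → K) →ₗ[K] K) : (linPoly f).IsHomogeneous 1 :=
  IsHomogeneous.sum _ _ _ fun i _ => isHomogeneous_C_mul_X _ i

lemma linPoly_ne_zero {f : (Fin n → K) →ₗ[K] K} (hf : f ≠ 0) : linPoly f ≠ 0 := by
  intro h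
  exact hf (LinearMap.ext fun x => by rw [← eval_linPoly, h]; simp)

lemma eval_derivation_linPoly (θ : Der K n) (f : (Fin n → K) →ₗ[K] K) (x : Fin n → K) :
    eval x (θ (linPoly f)) = f (vf θ x) := by
  rw [linearForm_apply f]
  simp [linPoly, vf, ← algebraMap_eq]

/-- A polynomial vanishing on the kernel of a nonzero linear form is divisible by the form. -/
lemma linPoly_dvd_iff [Infinite K] {f : (Fin n → K) →ₗ[K] K} (hf : f ≠ 0)
    (F : MvPolynomial (Fin n) K) :
    linPoly f ∣ F ↔ ∀ x ∈ LinearMap.ker f, eval x F = 0 := by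
  constructor
  · rintro ⟨G, rfl⟩ x hx
    rw [map_mul, eval_linPoly, LinearMap.mem_ker.mp hx, zero_mul]
  · intro h
    obtain ⟨w, hw⟩ : ∃ w, f w = 1 := by
      obtain ⟨y, hy⟩ : ∃ y, f y ≠ 0 := by
        by_contra! h0
        exact hf (LinearMap.ext h0)
      exact ⟨(f y)⁻¹ • y, by simp [hy]⟩
    let σ : MvPolynomial (Fin n) K →ₐ[K] MvPolynomial (Fin n) K :=
      aeval fun i => X i - C (w i) * linPoly f
    have hσ : σ F = 0 := by
      refine MvPolynomial.funext fun x => ?_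
      have hx : x - f x • w ∈ LinearMap.ker f := by simp [hw]
      have : eval x (σ F) = eval (x - f x • w) F := by
        simp only [σ, aeval_def, algebraMap_eq]
        rw [← eval₂_id, ← coe_eval₂Hom, ← coe_eval₂Hom (f := C), ← RingHom.comp_apply]
        change _ = eval₂Hom (RingHom.id K) _ F
        congr 1
        ext i
        · simp
        · simp only [RingHom.comp_apply, eval₂Hom_X', coe_eval₂Hom, eval₂_id, map_sub, map_mul,
            eval_C, eval_linPoly, Pi.sub_apply, Pi.smul_apply, smul_eq_mul]
          ring
      rw [this, h _ hx, map_zero]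
    have key : ∀ G : MvPolynomial (Fin n) K, linPoly f ∣ G - σ G := by
      intro G
      induction G using MvPolynomial.induction_on with
      | C a => simp [σ, ← algebraMap_eq]
      | add p q hp hq => rw [map_add, add_sub_add_comm]; exact dvd_add hp hq
      | mul_X p i hp =>
        have : p * X i - σ (p * X i) = (p - σ p) * X i + σ p * (C (w i) * linPoly f) := by
          rw [map_mul]
          simp only [σ, aeval_X]
          ring
        rw [this]
        exact dvd_add (hp.mul_right _) ((dvd_mul_left _ _).mul_left _)
    simpa [hσ] using key F

lemma linPoly_not_isUnit {f : (Fin n → K) →ₗ[K] K} : ¬ IsUnit (linPoly f) := by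
  intro h
  have := h.map (eval (0 : Fin n → K))
  rw [eval_linPoly, map_zero] at this
  exact not_isUnit_zero this

lemma prime_linPoly [Infinite K] {f : (Fin n → K) →ₗ[K] K} (hf : f ≠ 0) : Prime (linPoly f) := by
  refine ⟨linPoly_ne_zero hf, linPoly_not_isUnit, fun F G h => ?_⟩
  by_contra! hFG
  rw [linPoly_dvd_iff hf] at h
  have hFG' := hFG
  simp only [linPoly_dvd_iff hf, not_forall] at hFG'
  obtain ⟨⟨a, ha, hFa⟩, b, hb, hGb⟩ := hFG'
  let τ : MvPolynomial (Fin n) K →+* Polynomial K :=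
    eval₂Hom Polynomial.C fun i => Polynomial.C (a i) + Polynomial.C (b i - a i) * Polynomial.X
  have hτ : ∀ (P : MvPolynomial (Fin n) K) (t : K),
      (τ P).eval t = eval (a + t • (b - a)) P := by
    intro P t
    change ((Polynomial.evalRingHom t).comp τ) P = _
    congr 1
    ext i
    · simp [τ]
    · simp [τ]; ring
  have hz : τ F * τ G = 0 := by
    refine Polynomial.funext fun t => ?_
    rw [← map_mul, hτ, h _ (Submodule.add_mem _ ha
      (Submodule.smul_mem _ _ (Submodule.sub_mem _ hb ha))), Polynomial.eval_zero]
  rcases mul_eq_zero.mp hz with h0 | h0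
  · apply hFa
    have := hτ F 0
    rw [h0] at this
    simpa using this.symm
  · apply hGb
    have := hτ G 1
    rw [h0] at this
    simpa using this.symm

lemma ker_eq_of_le {f g : (Fin n → K) →ₗ[K] K} (hg : g ≠ 0)
    (h : LinearMap.ker f ≤ LinearMap.ker g) : LinearMap.ker f = LinearMap.ker g := by
  refine le_antisymm h fun x hx => ?_
  by_contra hfx
  rw [LinearMap.mem_ker] at hx hfx
  refine hg (LinearMap.ext fun w => ?_)
  have hw : w - (f w / f x) • x ∈ LinearMap.ker f := by simp [hfx]
  simpa [hx] using h hw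

lemma ker_eq_of_linPoly_dvd [Infinite K] {f g : (Fin n → K) →ₗ[K] K} (hf : f ≠ 0) (hg : g ≠ 0)
    (h : linPoly f ∣ linPoly g) : LinearMap.ker f = LinearMap.ker g := by
  refine ker_eq_of_le hg fun x hx => ?_
  have := (linPoly_dvd_iff hf _).1 h x hx
  rwa [eval_linPoly] at this

end Generic

section Divisibility

variable {K R ι : Type*} [CommRing K] [CommRing R] [Algebra K R]

lemma not_dvd_prod_of_notMem {p : ι → R} {s : Finset ι} {a : ι} (ha : a ∉ s) (hpa : Prime (p a))
    (hnd : ∀ j ∈ s, p a ∣ p j → a = j) : ¬ p a ∣ ∏ i ∈ s, p i := fun h => by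
  obtain ⟨j, hj, hd⟩ := (hpa.dvd_finsetProd_iff _).1 h
  exact ha (hnd j hj hd ▸ hj)

lemma prod_dvd_of_prime {p : ι → R} {s : Finset ι} (hp : ∀ i ∈ s, Prime (p i))
    (hnd : ∀ i ∈ s, ∀ j ∈ s, p i ∣ p j → i = j) {F : R} (h : ∀ i ∈ s, p i ∣ F) :
    ∏ i ∈ s, p i ∣ F := by
  induction s using Finset.induction_on with
  | empty => simp
  | insert a s ha ih =>
    obtain ⟨G, rfl⟩ := ih (fun i hi => hp i (by simp [hi]))
      (fun i hi j hj => hnd i (by simp [hi]) j (by simp [hj])) (fun i hi => h i (by simp [hi]))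
    have hpa := hp a (by simp)
    rw [Finset.prod_insert ha, mul_comm]
    exact mul_dvd_mul_left _ ((hpa.dvd_or_dvd (h a (by simp))).resolve_left
      (not_dvd_prod_of_notMem ha hpa fun j hj => hnd a (by simp) j (by simp [hj])))

lemma prod_dvd_derivation_iff [IsDomain R] {p : ι → R} {s : Finset ι} (hp : ∀ i ∈ s, Prime (p i))
    (hnd : ∀ i ∈ s, ∀ j ∈ s, p i ∣ p j → i = j) (θ : Derivation K R R) :
    ∏ i ∈ s, p i ∣ θ (∏ i ∈ s, p i) ↔ ∀ i ∈ s, p i ∣ θ (p i) := by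
  induction s using Finset.induction_on with
  | empty => simp
  | insert a s ha ih =>
    have hpa := hp a (by simp)
    have ih := ih (fun i hi => hp i (by simp [hi]))
      (fun i hi j hj => hnd i (by simp [hi]) j (by simp [hj]))
    have hnot := not_dvd_prod_of_notMem ha hpa fun j hj => hnd a (by simp) j (by simp [hj])
    have key (h : p a ∣ θ (p a)) : ∏ i ∈ insert a s, p i ∣ θ (∏ i ∈ insert a s, p i) ↔
        ∏ i ∈ s, p i ∣ θ (∏ i ∈ s, p i) := by
      rw [Finset.prod_insert ha, Derivation.leibniz, smul_eq_mul, smul_eq_mul,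
        dvd_add_left (by rw [mul_comm]; exact mul_dvd_mul_left _ h),
        mul_dvd_mul_iff_left hpa.ne_zero]
    rw [Finset.forall_mem_insert, ← ih]
    constructor
    · intro h
      have h' := (Dvd.intro _ (Finset.prod_insert ha).symm).trans h
      rw [Finset.prod_insert ha, Derivation.leibniz, smul_eq_mul, smul_eq_mul,
        dvd_add_right (dvd_mul_right _ _)] at h'
      have h'' := (hpa.dvd_or_dvd h').resolve_left hnot
      exact ⟨h'', (key h'').1 h⟩
    · exact fun h => (key h.1).2 h.2

end Divisibility

section Defining

variable {K : Type*} [Field K] {n : ℕ} {A : Arrangement K n} {Q : MvPolynomial (Fin n) K}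

lemma exists_isDefiningPoly (A : Arrangement K n) : ∃ Q, IsDefiningPoly A Q := by
  choose! α h using A.isHyp
  exact ⟨_, α, fun H hH => ⟨(h H hH).1, (h H hH).2.symm⟩, rfl⟩

lemma IsDefiningPoly.ne_zero (hQ : IsDefiningPoly A Q) : Q ≠ 0 := by
  obtain ⟨α, h, rfl⟩ := hQ
  exact Finset.prod_ne_zero_iff.2 fun H hH => linPoly_ne_zero (h H hH).1

lemma IsDefiningPoly.isHomogeneous (hQ : IsDefiningPoly A Q) :
    Q.IsHomogeneous A.hyperplanes.card := by
  obtain ⟨α, h, rfl⟩ := hQ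
  simpa using IsHomogeneous.prod A.hyperplanes (fun H => linPoly (α H)) (fun _ => 1)
    fun H _ => linPoly_isHomogeneous _

variable [Infinite K]

lemma IsDefiningPoly.mem_iff (hQ : IsDefiningPoly A Q) {θ : Der K n} :
    θ ∈ DerModule Q ↔ Tangent A θ := by
  obtain ⟨α, h, rfl⟩ := hQ
  change θ _ ∈ Ideal.span {_} ↔ _
  rw [Ideal.mem_span_singleton, prod_dvd_derivation_iff (fun H hH => prime_linPoly (h H hH).1)]
  · refine forall₂_congr fun H hH => ?_
    rw [linPoly_dvd_iff (h H hH).1]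
    refine forall_congr' fun x => ?_
    rw [(h H hH).2, eval_derivation_linPoly]
    refine imp_congr_right fun _ => ?_
    rw [← LinearMap.mem_ker, (h H hH).2]
  · intro H hH H' hH' hd
    rw [← (h H hH).2, ← (h H' hH').2]
    exact ker_eq_of_linPoly_dvd (h H hH).1 (h H' hH').1 hd

lemma IsDefiningPoly.dvd (hQ : IsDefiningPoly A Q) {F : MvPolynomial (Fin n) K}
    (hF : ∀ H ∈ A.hyperplanes, ∀ x ∈ H, eval x F = 0) : Q ∣ F := by
  obtain ⟨α, h, rfl⟩ := hQ
  refine prod_dvd_of_prime (fun H hH => prime_linPoly (h H hH).1) ?_ fun H hH => ?_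
  · intro H hH H' hH' hd
    rw [← (h H hH).2, ← (h H' hH').2]
    exact ker_eq_of_linPoly_dvd (h H hH).1 (h H' hH').1 hd
  · rw [linPoly_dvd_iff (h H hH).1, (h H hH).2]
    exact hF H hH

lemma IsDefiningPoly.ker_mem (hQ : IsDefiningPoly A Q) {f : (Fin n → K) →ₗ[K] K} (hf : f ≠ 0)
    (hd : linPoly f ∣ Q) : LinearMap.ker f ∈ A.hyperplanes := by
  obtain ⟨α, h, rfl⟩ := hQ
  obtain ⟨H, hH, hd⟩ := ((prime_linPoly hf).dvd_finsetProd_iff _).1 hd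
  rwa [ker_eq_of_linPoly_dvd hf (h H hH).1 hd, (h H hH).2]

end Defining

section Determinant

variable {K : Type*} [Field K] {n : ℕ}

/-- The determinant of the coefficients of a family of derivations. -/
noncomputable def coefDet (θ : Fin n → Der K n) : MvPolynomial (Fin n) K :=
  (Matrix.of fun i j => θ i (X j)).det

lemma eval_coefDet (θ : Fin n → Der K n) (x : Fin n → K) :
    eval x (coefDet θ) = (Matrix.of fun i => vf (θ i) x).det := by
  rw [coefDet, RingHom.map_det]
  rfl

lemma vf_smul (F : MvPolynomial (Fin n) K) (θ : Der K n) (x : Fin n → K) :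
    vf (F • θ) x = eval x F • vf θ x := by
  ext i
  simp [vf]

lemma vf_add (θ η : Der K n) (x : Fin n → K) : vf (θ + η) x = vf θ x + vf η x := by
  ext i
  simp [vf]

lemma det_eq_zero_of_mem_ker {f : (Fin n → K) →ₗ[K] K} (hf : f ≠ 0) {M : Matrix (Fin n) (Fin n) K}
    (h : ∀ i, f (M i) = 0) : M.det = 0 := by
  refine Matrix.exists_mulVec_eq_zero_iff.1 ⟨fun i => f (Pi.single i 1), fun h0 => hf ?_, ?_⟩
  · refine LinearMap.ext fun x => ?_
    rw [linearForm_apply f]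
    simp [congrFun h0 _]
  · ext i
    rw [Pi.zero_apply, ← h i, linearForm_apply f]
    simp [Matrix.mulVec, dotProduct, mul_comm]

lemma IsDefiningPoly.dvd_coefDet [Infinite K] {A : Arrangement K n} {Q : MvPolynomial (Fin n) K}
    (hQ : IsDefiningPoly A Q) {θ : Fin n → Der K n} (hθ : ∀ i, Tangent A (θ i)) :
    Q ∣ coefDet θ := by
  refine hQ.dvd fun H hH x hx => ?_
  obtain ⟨f, hf, rfl⟩ := A.isHyp H hH
  rw [eval_coefDet]
  exact det_eq_zero_of_mem_ker hf fun i => hθ i _ hH x hx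

lemma coefDet_isHomogeneous {θ : Fin n → Der K n} {d : Fin n → ℕ}
    (hθ : ∀ i j, (θ i (X j)).IsHomogeneous (d i)) : (coefDet θ).IsHomogeneous (∑ i, d i) := by
  rw [coefDet, Matrix.det_apply']
  refine IsHomogeneous.sum _ _ _ fun σ _ => ?_
  have h := IsHomogeneous.prod Finset.univ (fun i => θ (σ i) (X i)) (fun i => d (σ i))
    fun i _ => hθ _ _
  rw [Equiv.sum_comp σ d] at h
  have h1 : ((Equiv.Perm.sign σ : ℤ) : MvPolynomial (Fin n) K)
      = C ((Equiv.Perm.sign σ : ℤ) : K) := by simp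
  rw [← zero_add (∑ i, d i)]
  exact h1 ▸ (isHomogeneous_C (Fin n) _).mul h

lemma der_ext {θ η : Der K n} (h : ∀ i, θ (X i) = η (X i)) : θ = η :=
  MvPolynomial.derivation_ext h

lemma sum_smul_apply {ι : Type*} (s : Finset ι) (c : ι → MvPolynomial (Fin n) K) (θ : ι → Der K n)
    (F : MvPolynomial (Fin n) K) : (∑ i ∈ s, c i • θ i) F = ∑ i ∈ s, c i * θ i F := by
  change evalDer F _ = _
  rw [map_sum]
  rfl

lemma coefDet_smul_eq (θ : Fin n → Der K n) (η : Der K n) :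
    coefDet θ • η = ∑ i, coefDet (Function.update θ i η) • θ i := by
  refine der_ext fun j => ?_
  rw [sum_smul_apply]
  have h := congrFun (Matrix.mulVec_cramer (Matrix.of fun i j => θ i (X j))ᵀ fun j => η (X j)) j
  rw [Matrix.det_transpose, Pi.smul_apply, smul_eq_mul] at h
  refine h.symm.trans ?_
  change ∑ i : Fin n, _ * _ = _
  refine Finset.sum_congr rfl fun i _ => ?_
  rw [Matrix.cramer_transpose_apply, mul_comm, Matrix.transpose_apply, Matrix.of_apply]
  congr 2
  ext k l
  by_cases hk : k = i
  · subst hk; simp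
  · simp [hk]

lemma coefDet_smul (c : Fin n → MvPolynomial (Fin n) K) (θ : Fin n → Der K n) :
    coefDet (fun i => c i • θ i) = (∏ i, c i) * coefDet θ := by
  rw [coefDet, coefDet, ← Matrix.det_mul_column]
  rfl

lemma coefDet_dvd_of_basis {Q : MvPolynomial (Fin n) K}
    (b : Basis (Fin n) (MvPolynomial (Fin n) K) (DerModule Q)) {η : Fin n → Der K n}
    (hη : ∀ i, η i ∈ DerModule Q) : coefDet (fun i => (b i : Der K n)) ∣ coefDet η := by
  refine ⟨(Matrix.of fun i k => b.repr ⟨η i, hη i⟩ k).det, ?_⟩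
  rw [mul_comm, coefDet, coefDet, ← Matrix.det_mul]
  congr 1
  ext1 i j
  have h := congrArg (fun t : DerModule Q => (t : Der K n) (X j)) (b.sum_repr ⟨η i, hη i⟩)
  simp only [Submodule.coe_sum, Submodule.coe_smul, sum_smul_apply] at h
  exact h.symm

lemma linearIndependent_of_coefDet_ne_zero {θ : Fin n → Der K n} (h : coefDet θ ≠ 0) :
    LinearIndependent (MvPolynomial (Fin n) K) θ := by
  have h' := Matrix.linearIndependent_rows_of_det_ne_zero h
  let φ : Der K n →ₗ[MvPolynomial (Fin n) K] (Fin n → MvPolynomial (Fin n) K) :=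
    { toFun := fun θ j => θ (X j), map_add' := fun _ _ => rfl, map_smul' := fun _ _ => rfl }
  exact LinearIndependent.of_comp φ h'

end Determinant

section Exponents

variable {K : Type*} [Field K] {n : ℕ} {A : Arrangement K n} {Q : MvPolynomial (Fin n) K}

lemma degree_add_of_mul {P G : MvPolynomial (Fin n) K} {p f : ℕ} (hP : P.IsHomogeneous p)
    (hF : (P * G).IsHomogeneous f) (h0 : P * G ≠ 0) : p + G.totalDegree = f := by
  rw [← hF.totalDegree h0, totalDegree_mul_of_isDomain (left_ne_zero_of_mul h0)
    (right_ne_zero_of_mul h0), hP.totalDegree (left_ne_zero_of_mul h0)]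

lemma degree_le_of_dvd {P F : MvPolynomial (Fin n) K} {p f : ℕ} (hP : P.IsHomogeneous p)
    (hF : F.IsHomogeneous f) (h : P ∣ F) (h0 : F ≠ 0) : p ≤ f := by
  obtain ⟨G, rfl⟩ := h
  exact (Nat.le_add_right _ _).trans (degree_add_of_mul hP hF h0).le

/-- The coefficients of a derivation. -/
noncomputable def coeffs (K : Type*) [Field K] (n : ℕ) :
    Der K n ≃ₗ[MvPolynomial (Fin n) K] (Fin n → MvPolynomial (Fin n) K) where
  toFun θ j := θ (X j)
  map_add' _ _ := rfl
  map_smul' _ _ := rfl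
  invFun := mkDerivation K
  left_inv _ := der_ext fun i => mkDerivation_X _ _ i
  right_inv _ := _root_.funext fun i => mkDerivation_X _ _ i

lemma mem_derModule_self_smul (Q : MvPolynomial (Fin n) K) (θ : Der K n) : Q • θ ∈ DerModule Q :=
  Ideal.mem_span_singleton.2 (dvd_mul_right Q (θ Q))

lemma coefDet_self_smul (Q : MvPolynomial (Fin n) K) :
    coefDet (fun i => Q • (pderiv i : Der K n)) = Q ^ n := by
  rw [coefDet_smul, Finset.prod_const, Finset.card_univ, Fintype.card_fin]
  have : (Matrix.of fun i j : Fin n => (pderiv i (X j) : MvPolynomial (Fin n) K)) = 1 := by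
    ext1 i j
    rw [Matrix.of_apply, pderiv_X, Matrix.one_apply, Pi.single_apply]
    simp [eq_comm]
  rw [coefDet, this, det_one, mul_one]

lemma card_basis_derModule (hQ : Q ≠ 0) {ι : Type*} [Fintype ι]
    (b : Basis ι (MvPolynomial (Fin n) K) (DerModule Q)) : Fintype.card ι = n := by
  have hfr : finrank (MvPolynomial (Fin n) K) (Der K n) = n := by
    rw [(coeffs K n).finrank_eq]
    simp
  have : Module.Finite (MvPolynomial (Fin n) K) (Der K n) :=
    Module.Finite.equiv (coeffs K n).symm
  have : Module.Finite (MvPolynomial (Fin n) K) (DerModule Q) := Module.Finite.of_basis b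
  apply le_antisymm
  · rw [← finrank_eq_card_basis b]
    exact (Submodule.finrank_le (DerModule Q)).trans hfr.le
  · have h := linearIndependent_of_coefDet_ne_zero
      (θ := fun i => Q • (pderiv i : Der K n)) (by
        rw [coefDet_self_smul]; exact pow_ne_zero _ hQ)
    have h' : LinearIndependent (MvPolynomial (Fin n) K)
        (fun i => (⟨_, mem_derModule_self_smul Q (pderiv i)⟩ : DerModule Q)) :=
      LinearIndependent.of_comp (DerModule Q).subtype h
    simpa [finrank_eq_card_basis b] using h'.fintype_card_le_finrank

lemma HasExponents.exists_basis {e : Multiset ℕ} (h : HasExponents A e) :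
    ∃ Q, IsDefiningPoly A Q ∧ ∃ (d : Fin n → ℕ)
      (b : Basis (Fin n) (MvPolynomial (Fin n) K) (DerModule Q)),
      e = Finset.univ.val.map d ∧ ∀ i, IsHomogeneousDer (b i : Der K n) (d i) := by
  obtain ⟨Q, hQ, l, b, rfl, hb⟩ := h
  have hl : l.length = n := by simpa using card_basis_derModule hQ.ne_zero b
  subst hl
  exact ⟨Q, hQ, l.get, b, by simp, hb⟩

lemma coefDet_basis_ne_zero (hQ : Q ≠ 0)
    (b : Basis (Fin n) (MvPolynomial (Fin n) K) (DerModule Q)) :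
    coefDet (fun i => (b i : Der K n)) ≠ 0 := fun h => by
  have := coefDet_dvd_of_basis b fun i => mem_derModule_self_smul Q (pderiv i)
  rw [h, zero_dvd_iff, coefDet_self_smul] at this
  exact pow_ne_zero _ hQ this

/-- Saito's criterion: expansion of a tangent derivation in a family whose determinant is
a multiple of the defining polynomial. -/
lemma IsDefiningPoly.exists_expansion [Infinite K] (hQ : IsDefiningPoly A Q) {θ : Fin n → Der K n}
    (hθ : ∀ i, Tangent A (θ i)) {c : K} (hc : c ≠ 0) (hdet : coefDet θ = C c * Q) {η : Der K n}
    (hη : Tangent A η) :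
    ∃ g : Fin n → MvPolynomial (Fin n) K, η = ∑ i, g i • θ i ∧
      ∀ i, coefDet (Function.update θ i η) = coefDet θ * g i := by
  have h (i : Fin n) : ∃ g, coefDet (Function.update θ i η) = coefDet θ * g := by
    obtain ⟨g, hg⟩ := hQ.dvd_coefDet (θ := Function.update θ i η) fun j => by
      by_cases hj : j = i
      · subst hj; simpa using hη
      · simpa [hj] using hθ j
    refine ⟨C c⁻¹ * g, ?_⟩
    have hcc : C c * C c⁻¹ = (1 : MvPolynomial (Fin n) K) := by rw [← C_mul, mul_inv_cancel₀ hc, C_1]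
    rw [hg, hdet]
    linear_combination (-Q * g) * hcc
  choose g hg using h
  refine ⟨g, ?_, hg⟩
  have h0 : coefDet θ ≠ 0 := by
    rw [hdet]
    exact mul_ne_zero (by simpa using hc) hQ.ne_zero
  refine der_ext fun j => mul_left_cancel₀ h0 ?_
  have := congrArg (fun t : Der K n => t (X j)) (coefDet_smul_eq θ η)
  simp only [hg, mul_smul, ← Finset.smul_sum] at this
  exact this

lemma IsDefiningPoly.isFree [Infinite K] (hQ : IsDefiningPoly A Q) {θ : Fin n → Der K n}
    (hθ : ∀ i, Tangent A (θ i)) {c : K} (hc : c ≠ 0) (hdet : coefDet θ = C c * Q) :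
    IsFree A := by
  have h0 : coefDet θ ≠ 0 := by
    rw [hdet]
    exact mul_ne_zero (by simpa using hc) hQ.ne_zero
  refine ⟨Q, hQ, Module.Free.of_basis (Basis.mk
    (v := fun i => (⟨θ i, hQ.mem_iff.2 (hθ i)⟩ : DerModule Q)) ?_ ?_)⟩
  · exact LinearIndependent.of_comp (DerModule Q).subtype (linearIndependent_of_coefDet_ne_zero h0)
  · rintro ⟨η, hη⟩ -
    obtain ⟨g, hg, -⟩ := hQ.exists_expansion hθ hc hdet (hQ.mem_iff.1 hη)
    refine (Submodule.mem_span_range_iff_exists_fun _).2 ⟨g, ?_⟩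
    ext1
    simp [hg]

lemma IsDefiningPoly.exists_graded_expansion [Infinite K] (hQ : IsDefiningPoly A Q)
    {θ : Fin n → Der K n} (hθ : ∀ i, Tangent A (θ i)) {c : K} (hc : c ≠ 0)
    (hdet : coefDet θ = C c * Q) {d : Fin n → ℕ} (hd : ∀ i j, (θ i (X j)).IsHomogeneous (d i))
    {η : Der K n} (hη : Tangent A η) {p : ℕ} (hp : ∀ j, (η (X j)).IsHomogeneous p) :
    ∃ g : Fin n → MvPolynomial (Fin n) K, η = ∑ i, g i • θ i ∧
      ∀ i, g i ≠ 0 → d i + (g i).totalDegree = p := by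
  obtain ⟨g, hg, hgi⟩ := hQ.exists_expansion hθ hc hdet hη
  refine ⟨g, hg, fun i hi => ?_⟩
  have h0 : coefDet θ ≠ 0 := by
    rw [hdet]
    exact mul_ne_zero (by simpa using hc) hQ.ne_zero
  have hu : (coefDet (Function.update θ i η)).IsHomogeneous (∑ j, Function.update d i p j) :=
    coefDet_isHomogeneous fun k j => by
      by_cases hk : k = i
      · subst hk; simpa using hp j
      · simpa [hk] using hd k j
  rw [hgi i] at hu
  have h := degree_add_of_mul (coefDet_isHomogeneous hd) hu (mul_ne_zero h0 hi)
  rw [Finset.sum_update_of_mem (Finset.mem_univ i),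
    ← Finset.add_sum_erase _ d (Finset.mem_univ i), ← Finset.sdiff_singleton_eq_erase] at h
  omega

end Exponents

section Euler

variable {K : Type*} [Field K] {n : ℕ}

/-- The Euler derivation. -/
noncomputable def euler (K : Type*) [Field K] (n : ℕ) : Der K n := mkDerivation K X

@[simp] lemma euler_X (i : Fin n) : euler K n (X i) = X i := mkDerivation_X _ _ i

lemma vf_euler (x : Fin n → K) : vf (euler K n) x = x := by
  ext i
  simp [vf]

lemma tangent_euler (A : Arrangement K n) : Tangent A (euler K n) := fun _ _ x hx => by
  rwa [vf_euler]

lemma eq_zero_of_coefDet_euler {b : Fin 2 → Der K 2}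
    (h : ∀ i, coefDet ![b i, euler K 2] = 0) : coefDet b = 0 := by
  have h0 := h 0
  have h1 := h 1
  simp only [coefDet, det_fin_two, of_apply, cons_val_zero, cons_val_one, euler_X] at h0 h1 ⊢
  refine (mul_eq_zero.1 ?_).resolve_left (X_ne_zero (R := K) (0 : Fin 2))
  linear_combination b 1 (X 0) * h0 - b 0 (X 0) * h1

lemma HasExponents.rank_two [CharZero K] {B : Arrangement K 2} {e : Multiset ℕ}
    (h : HasExponents B e) : ∃ d d', e = {d, d'} ∧ d + d' = B.hyperplanes.card ∧
      (2 ≤ B.hyperplanes.card → d = 1) := by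
  obtain ⟨Q, hQ, d, b, rfl, hb⟩ := h.exists_basis
  have hQ0 := hQ.ne_zero
  have hD0 := coefDet_basis_ne_zero hQ0 b
  have hQD : Q ∣ coefDet fun i => (b i : Der K 2) :=
    hQ.dvd_coefDet fun i => hQ.mem_iff.1 (b i).2
  have hDhom : (coefDet fun i => (b i : Der K 2)).IsHomogeneous (∑ i, d i) :=
    coefDet_isHomogeneous fun i j => (hb i).2 j
  obtain ⟨F, hF0, hFhom, hDF⟩ : ∃ F, F ≠ 0 ∧ F.IsHomogeneous B.hyperplanes.card ∧
      coefDet (fun i => (b i : Der K 2)) ∣ F := by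
    rcases Nat.eq_zero_or_pos B.hyperplanes.card with h0 | h0
    · refine ⟨Q ^ 2, pow_ne_zero _ hQ0, ?_, ?_⟩
      · simpa [h0] using hQ.isHomogeneous.pow 2
      · simpa [coefDet_self_smul] using
          coefDet_dvd_of_basis b fun i => mem_derModule_self_smul Q (pderiv i)
    · refine ⟨B.hyperplanes.card • Q, smul_ne_zero h0.ne' hQ0, ?_, ?_⟩
      · rw [nsmul_eq_mul, ← map_natCast (C (σ := Fin 2) (R := K)), ← zero_add B.hyperplanes.card]
        simpa using (isHomogeneous_C (Fin 2) (B.hyperplanes.card : K)).mul hQ.isHomogeneous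
      · let η : Der K 2 := -pderiv 1 Q • (pderiv 0 : Der K 2) + pderiv 0 Q • (pderiv 1 : Der K 2)
        have hη : η ∈ DerModule Q := by
          refine Ideal.mem_span_singleton.2 ?_
          change Q ∣ -pderiv 1 Q * pderiv 0 Q + pderiv 0 Q * pderiv 1 Q
          ring_nf
          exact dvd_zero _
        refine (coefDet_dvd_of_basis b (η := ![euler K 2, η]) ?_).trans (dvd_of_eq ?_)
        · intro i
          fin_cases i
          · exact hQ.mem_iff.2 (tangent_euler B)
          · exact hη
        · rw [← hQ.isHomogeneous.sum_X_mul_pderiv, Fin.sum_univ_two]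
          simp [coefDet, det_fin_two, pderiv_X, η]
  have hsum : d 0 + d 1 = B.hyperplanes.card := by
    rw [← Fin.sum_univ_two]
    exact le_antisymm (degree_le_of_dvd hDhom hFhom hDF hF0)
      (degree_le_of_dvd hQ.isHomogeneous hDhom hQD hD0)
  have hexp : (Finset.univ.val.map d : Multiset ℕ) = {d 0, d 1} := by
    simp [Multiset.insert_eq_cons, ← Multiset.cons_coe]
  by_cases hm : 2 ≤ B.hyperplanes.card
  · have hQe (i : Fin 2) : Q ∣ coefDet ![(b i : Der K 2), euler K 2] :=
      hQ.dvd_coefDet fun j => by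
        fin_cases j
        · exact hQ.mem_iff.1 (b i).2
        · exact tangent_euler B
    have hhom (i : Fin 2) : (coefDet ![(b i : Der K 2), euler K 2]).IsHomogeneous (d i + 1) := by
      have := coefDet_isHomogeneous (θ := ![(b i : Der K 2), euler K 2]) (d := ![d i, 1]) fun k j => by
        fin_cases k
        · exact (hb i).2 j
        · simpa using isHomogeneous_X K j
      simpa using this
    have hpos (i : Fin 2) : d i ≠ 0 := fun h0 => by
      refine (hb i).1 (der_ext fun j => ?_)
      have hz : coefDet ![(b i : Der K 2), euler K 2] = 0 := by
        by_contra hne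
        have := degree_le_of_dvd hQ.isHomogeneous (hhom i) (hQe i) hne
        omega
      have hC (j : Fin 2) : ∃ c, (b i : Der K 2) (X j) = C c :=
        ⟨_, totalDegree_eq_zero_iff_eq_C.1 (Nat.le_zero.1 (h0 ▸ ((hb i).2 j).totalDegree_le))⟩
      choose c hc using hC
      simp only [coefDet, det_fin_two, of_apply, cons_val_zero, cons_val_one, euler_X, hc] at hz
      have e0 := congrArg (eval ![1, 0]) hz
      have e1 := congrArg (eval ![0, 1]) hz
      simp at e0 e1
      fin_cases j <;> simp [hc, e0, e1]
    obtain ⟨i, hi⟩ : ∃ i, coefDet ![(b i : Der K 2), euler K 2] ≠ 0 := by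
      by_contra! h0
      exact hD0 (eq_zero_of_coefDet_euler h0)
    have hle := degree_le_of_dvd hQ.isHomogeneous (hhom i) (hQe i) hi
    have h0 := hpos 0
    have h1 := hpos 1
    fin_cases i
    · exact ⟨d 1, d 0, hexp.trans (Multiset.pair_comm _ _), by omega, fun _ => by
        simp at hle; omega⟩
    · exact ⟨d 0, d 1, hexp, hsum, fun _ => by simp at hle; omega⟩
  · exact ⟨d 0, d 1, hexp, hsum, fun h => absurd h hm⟩

end Euler

section Restriction

variable {K : Type*} [Field K] {n : ℕ}

/-- The set of traces of the hyperplanes of `A` on a subspace `H`. -/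
noncomputable def traces (A : Arrangement K n) (H : Submodule K (Fin n → K)) :
    Finset (Submodule K (Fin n → K)) :=
  (A.hyperplanes.erase H).image (H ⊓ ·)

lemma IsRestriction.card_eq {A : Arrangement K (n + 1)} {H : Submodule K (Fin (n + 1) → K)}
    {B : Arrangement K n} (h : IsRestriction A H B) :
    B.hyperplanes.card = (traces A H).card := by
  obtain ⟨e, he⟩ := h
  have h1 : B.hyperplanes = ((A.hyperplanes.erase H).image fun H' => H'.comap H.subtype).image
      (Submodule.map (e : H →ₗ[K] (Fin n → K))) := by
    rw [he, Finset.image_image]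
    rfl
  have h2 : traces A H = ((A.hyperplanes.erase H).image fun H' => H'.comap H.subtype).image
      (Submodule.map H.subtype) := by
    rw [Finset.image_image]
    exact Finset.image_congr fun H' _ => (Submodule.map_comap_subtype H H').symm
  rw [h1, h2, Finset.card_image_of_injective _ (Submodule.map_injective_of_injective e.injective),
    Finset.card_image_of_injective _ (Submodule.map_injective_of_injective H.injective_subtype)]

lemma RecursivelyFree.exists_add_or_del {A : Arrangement K (n + 1)} (h : RecursivelyFree K A)
    (hA : A.hyperplanes.Nonempty) :
    (∃ H ∈ A.hyperplanes, ∃ (B : Arrangement K n) (e' e'' : Multiset ℕ), IsRestriction A H B ∧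
      HasExponents (A.delete H) e' ∧ HasExponents B e'' ∧ e'' ≤ e') ∨
    ∃ (X : Arrangement K (n + 1)), ∃ H ∈ X.hyperplanes, A = X.delete H ∧
      ∃ (B : Arrangement K n) (e e'' : Multiset ℕ), IsRestriction X H B ∧
        HasExponents X e ∧ HasExponents B e'' ∧ e'' ≤ e := by
  cases h with
  | empty => simp [emptyArr] at hA
  | add _ H hH B hB e' e'' _ _ h3 h4 h5 => exact .inl ⟨H, hH, B, e', e'', hB, h3, h4, h5⟩
  | del X H hH B hB e e'' _ _ h3 h4 h5 => exact .inr ⟨X, H, hH, rfl, B, e, e'', hB, h3, h4, h5⟩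

lemma exists_of_pair_le {ι : Type*} [Fintype ι] {δ : ι → ℕ} {a b : ℕ}
    (h : ({a, b} : Multiset ℕ) ≤ Finset.univ.val.map δ) :
    ∃ i j, i ≠ j ∧ δ i = a ∧ δ j = b := by
  obtain ⟨i, -, rfl⟩ := Multiset.mem_map.1 (Multiset.mem_of_le h (Multiset.mem_cons_self a {b}))
  have hu : (Finset.univ : Finset ι).val = i ::ₘ (Finset.univ.erase i).val := by
    rw [← Finset.insert_val_of_notMem (Finset.notMem_erase _ _),
      Finset.insert_erase (Finset.mem_univ i)]
  rw [hu, Multiset.map_cons, Multiset.insert_eq_cons, Multiset.cons_le_cons_iff,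
    Multiset.singleton_le] at h
  obtain ⟨j, hj, rfl⟩ := Multiset.mem_map.1 h
  exact ⟨i, j, (Finset.ne_of_mem_erase hj).symm, rfl, rfl⟩

lemma eq_zero_of_smul_basis_eq {ι R M : Type*} [CommRing R] [AddCommGroup M] [Module R M]
    (b : Basis ι R M) {i j : ι} (hij : i ≠ j) {s t : R} (h : s • b i = t • b j) : s = 0 := by
  have := congrArg (fun v => b.repr v i) h
  simpa [hij, hij.symm] using this

/-- Two members of a basis of `D(A)` do not have multiples that are multiples of one derivation. -/
lemma false_of_smul_eq_smul {Q : MvPolynomial (Fin n) K} {ι : Type*}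
    (b : Basis ι (MvPolynomial (Fin n) K) (DerModule Q)) {i j : ι} (hij : i ≠ j) {η : Der K n}
    {s g g' : MvPolynomial (Fin n) K} (hs : s ≠ 0) (hi : s • (b i : Der K n) = g • η)
    (hj : s • (b j : Der K n) = g' • η) : False := by
  have h : (g' * s) • b i = (g * s) • b j := by
    refine Subtype.ext ?_
    rw [Submodule.coe_smul, Submodule.coe_smul, mul_smul, mul_smul, hi, hj, smul_smul, smul_smul,
      mul_comm]
  have hg' : g' = 0 := (mul_eq_zero.1 (eq_zero_of_smul_basis_eq (M := DerModule Q) b hij h)).resolve_right hs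
  rw [hg', zero_smul] at hj
  have h' : s • b j = (0 : MvPolynomial (Fin n) K) • b i := by
    refine Subtype.ext ?_
    rw [Submodule.coe_smul, hj, zero_smul]
    rfl
  have h0 := eq_zero_of_smul_basis_eq (R := MvPolynomial (Fin n) K) (M := DerModule Q) b
    hij.symm (s := s) (t := 0)
  exact hs (h0 h')

lemma det_eq_zero_of_dependent {x y v : Fin 3 → K} {s t : K} (hst : ¬ (s = 0 ∧ t = 0))
    (h : s • x + t • y = 0) : (Matrix.of ![x, y, v]).det = 0 := by
  refine Matrix.exists_vecMul_eq_zero_iff.1 ⟨![s, t, 0], fun h0 => hst ?_, ?_⟩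
  · exact ⟨congrFun h0 0, congrFun h0 1⟩
  · ext j
    have := congrFun h j
    simpa [Matrix.vecMul, dotProduct, Fin.sum_univ_three] using this

lemma exists_dependent_of_det_eq_zero {f : (Fin 3 → K) →ₗ[K] K} {x y u : Fin 3 → K}
    (hx : f x = 0) (hy : f y = 0) (hu : f u ≠ 0) (h : (Matrix.of ![x, y, u]).det = 0) :
    ∃ s t : K, ¬ (s = 0 ∧ t = 0) ∧ s • x + t • y = 0 := by
  obtain ⟨w, hw, h0⟩ := Matrix.exists_vecMul_eq_zero_iff.2 h
  have h0' : w 0 • x + w 1 • y + w 2 • u = 0 := by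
    ext j
    have := congrFun h0 j
    simpa [Matrix.vecMul, dotProduct, Fin.sum_univ_three] using this
  have hw2 : w 2 = 0 := by
    have := congrArg f h0'
    simpa [hx, hy, hu] using this
  refine ⟨w 0, w 1, fun h1 => hw ?_, by simpa [hw2] using h0'⟩
  ext j
  fin_cases j
  exacts [h1.1, h1.2, hw2]

end Restriction

section RankThree

variable {K : Type*} [Field K] [CharZero K]

/-- A family of tangent derivations of degrees `1`, `11`, `15`, the first being the Euler
derivation, whose determinant is a multiple of a defining polynomial. -/
structure IsSaitoFamily (A : Arrangement K 3) (Q : MvPolynomial (Fin 3) K) (θ : Fin 3 → Der K 3)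
    (c : K) : Prop where
  defining : IsDefiningPoly A Q
  tangent : ∀ i, Tangent A (θ i)
  ne_zero : c ≠ 0
  det : coefDet θ = C c * Q
  homogeneous : ∀ i j, (θ i (X j)).IsHomogeneous (![1, 11, 15] i)
  euler : θ 0 = euler K 3

variable {A : Arrangement K 3} {Q : MvPolynomial (Fin 3) K} {θ : Fin 3 → Der K 3} {c : K}

lemma IsSaitoFamily.low_degree (hθ : IsSaitoFamily A Q θ c) {η : Der K 3} (hη : Tangent A η) {p : ℕ}
    (hp : ∀ j, (η (X j)).IsHomogeneous p) (hp11 : p ≤ 11) :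
    ∃ (g : MvPolynomial (Fin 3) K) (a : K), η = g • θ 0 + (C a : MvPolynomial (Fin 3) K) • θ 1 ∧ (a ≠ 0 → p = 11) := by
  obtain ⟨g, hg, hdeg⟩ := hθ.defining.exists_graded_expansion hθ.tangent hθ.ne_zero hθ.det
    hθ.homogeneous hη hp
  have h2 : g 2 = 0 := by
    by_contra h0
    have := hdeg 2 h0
    simp at this
    omega
  by_cases h1 : g 1 = 0
  · exact ⟨g 0, 0, by simpa [Fin.sum_univ_three, h1, h2] using hg, by simp⟩
  · have := hdeg 1 h1
    simp at this
    have hc : g 1 = C ((g 1).coeff 0) := totalDegree_eq_zero_iff_eq_C.1 (by omega)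
    refine ⟨g 0, (g 1).coeff 0, ?_, fun _ => by omega⟩
    rw [← hc]
    simpa [Fin.sum_univ_three, h2] using hg

lemma IsSaitoFamily.not_add (hθ : IsSaitoFamily A Q θ c) {H : Submodule K (Fin 3 → K)}
    (hH : H ∈ A.hyperplanes) {x : Fin 3 → K} (hx : x ∈ H) (hpar : ∀ s : K, vf (θ 1) x ≠ s • x)
    {B : Arrangement K 2} (hB : B.hyperplanes.card ≤ 11) {e' e'' : Multiset ℕ}
    (h' : HasExponents (A.delete H) e') (h'' : HasExponents B e'') : ¬ e'' ≤ e' := by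
  intro hle
  obtain ⟨d, d', rfl, hsum, hd⟩ := h''.rank_two
  obtain ⟨P, hP, δ, b, rfl, hb⟩ := h'.exists_basis
  obtain ⟨i, j, hij, hi, hj⟩ := exists_of_pair_le hle
  obtain ⟨f, hf, rfl⟩ := A.isHyp H hH
  have key (k : Fin 3) (hk : δ k ≤ 10) :
      ∃ g : MvPolynomial (Fin 3) K, linPoly f • (b k : Der K 3) = g • θ 0 := by
    have ht : Tangent A (linPoly f • (b k : Der K 3)) := by
      intro H' hH' y hy
      rw [vf_smul]
      by_cases hHH : H' = LinearMap.ker f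
      · subst hHH
        rw [eval_linPoly, LinearMap.mem_ker.1 hy, zero_smul]
        exact Submodule.zero_mem _
      · exact Submodule.smul_mem _ _
          (hP.mem_iff.1 (b k).2 H' (Finset.mem_erase.2 ⟨hHH, hH'⟩) y hy)
    obtain ⟨g, a, hg, ha⟩ := hθ.low_degree ht (p := 1 + δ k)
      (fun j => (linPoly_isHomogeneous f).mul ((hb k).2 j)) (by omega)
    have ha0 : a = 0 := by
      by_contra ha0
      have := congrArg (fun t => vf t x) hg
      simp only [vf_smul, vf_add, eval_linPoly, LinearMap.mem_ker.1 hx, zero_smul, hθ.euler,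
        vf_euler, eval_C] at this
      refine hpar (-(a⁻¹ * eval x g)) ?_
      rw [neg_smul, mul_smul, eq_neg_iff_add_eq_zero, ← smul_right_injective _ ha0 |>.eq_iff]
      simp only [smul_add, smul_smul, ← mul_assoc, mul_inv_cancel₀ ha0, one_mul, smul_zero]
      rw [add_comm]
      exact this.symm
    exact ⟨g, by simpa [ha0] using hg⟩
  obtain ⟨g, hg⟩ := key i (by omega)
  obtain ⟨g', hg'⟩ := key j (by omega)
  exact false_of_smul_eq_smul b hij (linPoly_ne_zero hf) hg hg'

end RankThree

section Deletion

variable {K : Type*} [Field K]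

lemma dvd_of_dvd_of_prime {R : Type*} [CommRing R] [IsDomain R] {p q D : R} (hp : Prime p)
    (hpq : ¬ p ∣ q) {k : ℕ} (h1 : D ∣ p ^ 2 * q) (h2 : D ∣ p * q ^ k) : D ∣ p * q := by
  obtain ⟨G, hG⟩ := h1
  by_cases h : p ∣ G
  · obtain ⟨G', rfl⟩ := h
    refine ⟨G', mul_left_cancel₀ hp.ne_zero ?_⟩
    linear_combination hG
  · have h3 : p ^ 2 ∣ p * q ^ k := (hp.pow_dvd_of_dvd_mul_right 2 h ⟨q, hG.symm⟩).trans h2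
    rw [pow_two] at h3
    exact absurd (hp.dvd_of_dvd_pow ((mul_dvd_mul_iff_left hp.ne_zero).1 h3)) hpq

/-- A derivation tangent to `A`, multiplied by a form defining `H`, is tangent to `A ∪ {H}`. -/
lemma tangent_of_delete {n : ℕ} {X : Arrangement K n} {f : (Fin n → K) →ₗ[K] K} {η : Der K n}
    (hη : Tangent (X.delete (LinearMap.ker f)) η) : Tangent X (linPoly f • η) := by
  intro H' hH' y hy
  rw [vf_smul]
  by_cases hHH : H' = LinearMap.ker f
  · subst hHH
    rw [eval_linPoly, LinearMap.mem_ker.1 hy, zero_smul]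
    exact Submodule.zero_mem _
  · exact Submodule.smul_mem _ _ (hη H' (Finset.mem_erase.2 ⟨hHH, hH'⟩) y hy)

lemma tangent_of_tangent_delete {n : ℕ} {X : Arrangement K n} {H : Submodule K (Fin n → K)}
    {η : Der K n} (hη : Tangent (X.delete H) η) (hH : ∀ x ∈ H, vf η x ∈ H) : Tangent X η := by
  intro H' hH' y hy
  by_cases hHH : H' = H
  · exact hHH ▸ hH y (hHH ▸ hy)
  · exact hη H' (Finset.mem_erase.2 ⟨hHH, hH'⟩) y hy

lemma tangent_self_smul [Infinite K] {n : ℕ} {A : Arrangement K n} {Q : MvPolynomial (Fin n) K}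
    (hQ : IsDefiningPoly A Q) (η : Der K n) : Tangent A (Q • η) :=
  hQ.mem_iff.1 (mem_derModule_self_smul Q η)

/-- The constant derivation with coefficients `w`. -/
noncomputable def constDer {n : ℕ} (w : Fin n → K) : Der K n := mkDerivation K fun i => C (w i)

lemma constDer_X {n : ℕ} (w : Fin n → K) (i : Fin n) : constDer w (X i) = C (w i) :=
  mkDerivation_X _ _ i

lemma vf_constDer {n : ℕ} (w x : Fin n → K) : vf (constDer w) x = w := by
  ext i
  simp [vf, constDer_X]

lemma exists_det_ne_zero (f : (Fin 3 → K) →ₗ[K] K) :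
    ∃ w : Fin 3 → Fin 3 → K, f (w 0) = 0 ∧ f (w 1) = 0 ∧ (Matrix.of w).det ≠ 0 := by
  set a : Fin 3 → K := fun i => f (Pi.single i 1) with ha
  have hfa (x : Fin 3 → K) : f x = a 0 * x 0 + a 1 * x 1 + a 2 * x 2 := by
    rw [linearForm_apply f, Fin.sum_univ_three]
  by_cases h0 : a 0 = 0
  · by_cases h1 : a 1 = 0
    · refine ⟨![![1, 0, 0], ![0, 1, 0], ![0, 0, 1]], ?_, ?_, ?_⟩
      · simp [hfa, h0]
      · simp [hfa, h1]
      · simp [det_fin_three]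
    · refine ⟨![![1, 0, 0], ![0, -a 2, a 1], ![0, 1, 0]], ?_, ?_, ?_⟩
      · simp [hfa, h0]
      · simp [hfa]; ring
      · simpa [det_fin_three] using h1
  · refine ⟨![![-a 1, a 0, 0], ![-a 2, 0, a 0], ![1, 0, 0]], ?_, ?_, ?_⟩
    · simp [hfa]; ring
    · simp [hfa]; ring
    · simpa [det_fin_three] using h0

lemma eval_aeval_linPoly {m n : ℕ} (φ : (Fin m → K) →ₗ[K] (Fin n → K))
    (F : MvPolynomial (Fin n) K) (y : Fin m → K) :
    eval y (aeval (fun i => linPoly (LinearMap.proj i ∘ₗ φ)) F) = eval (φ y) F := by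
  rw [← coe_aeval_eq_eval, ← coe_aeval_eq_eval]
  change ((aeval y).comp (aeval fun i => linPoly (LinearMap.proj i ∘ₗ φ))) F = aeval (φ y) F
  congr 1
  refine MvPolynomial.algHom_ext fun i => ?_
  rw [AlgHom.comp_apply, aeval_X, aeval_X]
  exact eval_linPoly _ _

lemma exists_pullback {m n d : ℕ} (φ : (Fin m → K) →ₗ[K] (Fin n → K))
    {D : MvPolynomial (Fin n) K} (hD : D.IsHomogeneous d) :
    ∃ P : MvPolynomial (Fin m) K, P.IsHomogeneous d ∧ ∀ y, eval y P = eval (φ y) D := by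
  refine ⟨aeval (fun i => linPoly (LinearMap.proj i ∘ₗ φ)) D, ?_, eval_aeval_linPoly φ D⟩
  have h := hD.aeval (n := 1) (fun i => linPoly (LinearMap.proj i ∘ₗ φ)) fun i =>
    linPoly_isHomogeneous _
  rwa [one_mul] at h

variable {A X : Arrangement K 3} {Q : MvPolynomial (Fin 3) K} {θ : Fin 3 → Der K 3} {c : K}

lemma IsSaitoFamily.exists_eval_eq_det (hθ : IsSaitoFamily A Q θ c) (u : Fin 3 → K) :
    ∃ D : MvPolynomial (Fin 3) K, D.IsHomogeneous 12 ∧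
      ∀ x, eval x D = (Matrix.of ![x, vf (θ 1) x, u]).det := by
  refine ⟨coefDet ![θ 0, θ 1, constDer u], ?_, fun x => ?_⟩
  · have := coefDet_isHomogeneous (θ := ![θ 0, θ 1, constDer u]) (d := ![1, 11, 0]) fun i j => by
      fin_cases i
      · exact hθ.homogeneous 0 j
      · exact hθ.homogeneous 1 j
      · simpa [constDer_X] using isHomogeneous_C (Fin 3) (u j)
    simpa [Fin.sum_univ_three] using this
  · rw [eval_coefDet]
    congr 1
    ext i j
    fin_cases i <;> simp [hθ.euler, vf_euler, vf_constDer]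

/-- Two vectors of a plane lying in the same line of it are linearly dependent. -/
lemma exists_dependent_of_mem {H : Submodule K (Fin 3 → K)} (e : H ≃ₗ[K] (Fin 2 → K))
    {h : (Fin 2 → K) →ₗ[K] K} (hh : h ≠ 0) {a b : H} (ha : h (e a) = 0) (hb : h (e b) = 0) :
    ∃ s t : K, ¬ (s = 0 ∧ t = 0) ∧ s • a + t • b = 0 := by
  have hdet := det_eq_zero_of_mem_ker hh (M := Matrix.of ![e a, e b]) fun i => by
    fin_cases i
    · exact ha
    · exact hb
  obtain ⟨w, hw, hw0⟩ := Matrix.exists_vecMul_eq_zero_iff.2 hdet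
  refine ⟨w 0, w 1, fun h01 => hw ?_, e.injective ?_⟩
  · ext j
    fin_cases j
    exacts [h01.1, h01.2]
  · rw [map_add, map_smul, map_smul, map_zero]
    ext j
    simpa [Matrix.vecMul, dotProduct] using congrFun hw0 j

lemma IsSaitoFamily.det_eq_zero_of_mem_restriction {f : (Fin 3 → K) →ₗ[K] K}
    (hθ : IsSaitoFamily (X.delete (LinearMap.ker f)) Q θ c)
    {B : Arrangement K 2} {e : LinearMap.ker f ≃ₗ[K] (Fin 2 → K)}
    (he : B.hyperplanes = (X.hyperplanes.erase (LinearMap.ker f)).image fun H' =>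
      Submodule.map (e : LinearMap.ker f →ₗ[K] (Fin 2 → K)) (H'.comap (LinearMap.ker f).subtype))
    (htan : ∀ x ∈ LinearMap.ker f, vf (θ 1) x ∈ LinearMap.ker f) (u : Fin 3 → K)
    {L : Submodule K (Fin 2 → K)} (hL : L ∈ B.hyperplanes) {z : LinearMap.ker f} (hz : e z ∈ L) :
    (Matrix.of ![(z : Fin 3 → K), vf (θ 1) z, u]).det = 0 := by
  obtain ⟨h, hh, rfl⟩ := B.isHyp L hL
  rw [he] at hL
  obtain ⟨H', hH', hLh⟩ := Finset.mem_image.1 hL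
  have hmap (a : LinearMap.ker f) : (a : Fin 3 → K) ∈ H' ↔ h (e a) = 0 := by
    rw [← LinearMap.mem_ker, ← hLh, Submodule.mem_map]
    refine ⟨fun ha => ⟨a, ha, rfl⟩, ?_⟩
    rintro ⟨a', ha', haa⟩
    rwa [← e.injective haa]
  have h1 := (hmap ⟨_, htan _ z.2⟩).1 (hθ.tangent 1 H' hH' _ ((hmap z).2 hz))
  obtain ⟨s, t, hst, h0⟩ := exists_dependent_of_mem e hh hz h1
  exact det_eq_zero_of_dependent hst (congrArg Subtype.val h0)

variable [CharZero K]

lemma IsSaitoFamily.coefDet_basis_dvd {f : (Fin 3 → K) →ₗ[K] K}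
    (hθ : IsSaitoFamily (X.delete (LinearMap.ker f)) Q θ c) (hf : f ≠ 0)
    {P : MvPolynomial (Fin 3) K} (hP : IsDefiningPoly X P)
    (b : Basis (Fin 3) (MvPolynomial (Fin 3) K) (DerModule P)) :
    coefDet (fun i => (b i : Der K 3)) ∣ linPoly f * Q := by
  have hfQ : ¬ linPoly f ∣ Q := fun h =>
    Finset.notMem_erase _ _ (hθ.defining.ker_mem hf h)
  have hC {a : K} (ha : a ≠ 0) : IsUnit (C a : MvPolynomial (Fin 3) K) := by simpa using ha
  refine dvd_of_dvd_of_prime (k := 3) (prime_linPoly hf) hfQ ?_ ?_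
  · have h := coefDet_dvd_of_basis b (η := fun i => ![1, linPoly f, linPoly f] i • θ i) fun i => by
      rw [hP.mem_iff]
      fin_cases i
      · simpa [hθ.euler] using tangent_euler X
      · exact tangent_of_delete (hθ.tangent 1)
      · exact tangent_of_delete (hθ.tangent 2)
    rw [coefDet_smul, hθ.det, mul_left_comm, (hC hθ.ne_zero).dvd_mul_left] at h
    simpa [Fin.prod_univ_three, pow_two] using h
  · obtain ⟨w, hw0, hw1, hw⟩ := exists_det_ne_zero f
    have hw' (i : Fin 3) (hi : f (w i) = 0) : Tangent X (Q • constDer (w i)) :=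
      tangent_of_tangent_delete (tangent_self_smul hθ.defining _) fun x _ => by
        rw [vf_smul, vf_constDer]
        exact Submodule.smul_mem _ _ hi
    have h := coefDet_dvd_of_basis b (η := fun i => ![Q, Q, linPoly f * Q] i • (constDer (w i) : Der K 3))
      fun i => by
        rw [hP.mem_iff]
        fin_cases i
        · exact hw' 0 hw0
        · exact hw' 1 hw1
        · change Tangent X ((linPoly f * Q) • _)
          rw [mul_smul]
          exact tangent_of_delete (tangent_self_smul hθ.defining _)
    have hd : coefDet (fun i => constDer (w i)) = C (Matrix.of w).det := by
      rw [RingHom.map_det, coefDet]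
      congr 1
      ext1 i j
      exact constDer_X (w i) j
    rw [coefDet_smul, hd, mul_comm, (hC hw).dvd_mul_left] at h
    refine h.trans (dvd_of_eq ?_)
    simp [Fin.prod_univ_three]
    ring

lemma IsSaitoFamily.not_tangent {H : Submodule K (Fin 3 → K)}
    (hθ : IsSaitoFamily (X.delete H) Q θ c) (hH : H ∈ X.hyperplanes) {B : Arrangement K 2}
    (hB : IsRestriction X H B) (hm : 13 ≤ B.hyperplanes.card) :
    ¬ ∀ x ∈ H, vf (θ 1) x ∈ H := by
  intro htan
  obtain ⟨f, hf, rfl⟩ := X.isHyp H hH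
  obtain ⟨e, he⟩ := hB
  obtain ⟨u, hu⟩ : ∃ u, f u ≠ 0 := by
    by_contra! h0
    exact hf (LinearMap.ext h0)
  obtain ⟨D, hDhom, hDe⟩ := hθ.exists_eval_eq_det u
  obtain ⟨P, hPhom, hPe⟩ : ∃ P : MvPolynomial (Fin 2) K, P.IsHomogeneous 12 ∧
      ∀ y, eval y P = eval (e.symm y : Fin 3 → K) D :=
    exists_pullback ((LinearMap.ker f).subtype ∘ₗ e.symm.toLinearMap) hDhom
  obtain ⟨QB, hQB⟩ := exists_isDefiningPoly B
  have hdvd : QB ∣ P := hQB.dvd fun L hL y hy => by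
    rw [hPe, hDe]
    exact hθ.det_eq_zero_of_mem_restriction he htan u hL (by simpa using hy)
  have hP0 : P = 0 := by
    by_contra hne
    have := degree_le_of_dvd hQB.isHomogeneous hPhom hdvd hne
    omega
  refine Finset.notMem_erase (LinearMap.ker f) X.hyperplanes (hθ.defining.ker_mem hf ?_)
  rw [linPoly_dvd_iff hf]
  intro x hx
  have h0 : (Matrix.of ![x, vf (θ 1) x, u]).det = 0 := by
    have := hPe (e ⟨x, hx⟩)
    rw [hP0, map_zero, e.symm_apply_apply, hDe] at this
    exact this.symm
  obtain ⟨s, t, hst, h1⟩ := exists_dependent_of_det_eq_zero hx (htan x hx) hu h0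
  have h2 : eval x (coefDet θ) = 0 := by
    rw [eval_coefDet]
    convert det_eq_zero_of_dependent (v := vf (θ 2) x) hst h1 using 2
    ext i j
    fin_cases i <;> simp [hθ.euler, vf_euler]
  rw [hθ.det, map_mul, eval_C] at h2
  exact (mul_eq_zero.1 h2).resolve_left hθ.ne_zero

lemma IsSaitoFamily.not_del {H : Submodule K (Fin 3 → K)}
    (hθ : IsSaitoFamily (X.delete H) Q θ c) (hcard : (X.delete H).hyperplanes.card = 27)
    (hH : H ∈ X.hyperplanes) {B : Arrangement K 2} (hB : IsRestriction X H B)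
    (hm : 17 ≤ B.hyperplanes.card) {e e'' : Multiset ℕ}
    (h : HasExponents X e) (h'' : HasExponents B e'') : ¬ e'' ≤ e := by
  intro hle
  obtain ⟨d, d', rfl, hsum, hd⟩ := h''.rank_two
  obtain rfl := hd (by omega)
  obtain ⟨P, hP, δ, b, rfl, hb⟩ := h.exists_basis
  obtain ⟨i, j, hij, hi, hj⟩ := exists_of_pair_le hle
  have hnot := hθ.not_tangent hH hB (by omega)
  obtain ⟨f, hf, rfl⟩ := X.isHyp H hH
  have hdeg : ∑ k, δ k ≤ 1 + 27 := by
    refine degree_le_of_dvd (coefDet_isHomogeneous fun k j => (hb k).2 j) ?_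
      (hθ.coefDet_basis_dvd hf hP b) (mul_ne_zero (linPoly_ne_zero hf) hθ.defining.ne_zero)
    exact (linPoly_isHomogeneous f).mul (hcard ▸ hθ.defining.isHomogeneous)
  obtain ⟨k, hki, hkj⟩ : ∃ k, k ≠ i ∧ k ≠ j := by
    clear hi hj
    revert i j
    decide
  have hk : δ k ≤ 11 := by
    have : δ i + (δ j + δ k) ≤ ∑ k, δ k := by
      rw [← Finset.sum_pair hkj.symm, ← Finset.sum_insert (s := {j, k}) (a := i)]
      · exact Finset.sum_le_sum_of_subset (Finset.subset_univ _)
      · simp [hij, hki.symm]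
    omega
  have ht (k : Fin 3) : Tangent (X.delete (LinearMap.ker f)) (b k : Der K 3) := fun H' hH' =>
    hP.mem_iff.1 (b k).2 H' (Finset.mem_of_mem_erase hH')
  obtain ⟨g, a, hg, ha⟩ := hθ.low_degree (ht i) (hb i).2 (by omega)
  obtain ⟨g', a', hg', -⟩ := hθ.low_degree (ht k) (hb k).2 hk
  have ha0 : a = 0 := by
    by_contra h0
    have := ha h0
    omega
  by_cases ha' : a' = 0
  · refine false_of_smul_eq_smul b hki (η := θ 0) (s := 1) (g := g') (g' := g) one_ne_zero ?_ ?_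
    · simpa [ha'] using hg'
    · simpa [ha0] using hg
  · refine hnot fun x hx => ?_
    have h1 := hP.mem_iff.1 (b k).2 _ hH x hx
    rw [hg', vf_add, vf_smul, vf_smul, hθ.euler, vf_euler, eval_C] at h1
    have h2 := (Submodule.add_mem_iff_right _ (Submodule.smul_mem _ _ hx)).1 h1
    exact (Submodule.smul_mem_iff _ ha').1 h2

/-- A criterion for a free arrangement with exponents `1, 11, 15` not to be recursively free. -/
lemma IsSaitoFamily.not_recursivelyFree (hθ : IsSaitoFamily A Q θ c)
    (hcard : A.hyperplanes.card = 27)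
    (hadd : ∀ H ∈ A.hyperplanes, (traces A H).card ≤ 11 ∧
      ∃ x ∈ H, ∀ s : K, vf (θ 1) x ≠ s • x)
    (hdel : ∀ X : Arrangement K 3, ∀ H ∈ X.hyperplanes, A = X.delete H →
      17 ≤ (traces X H).card) : ¬ RecursivelyFree K A := by
  intro h
  rcases h.exists_add_or_del (Finset.card_pos.1 (by omega)) with
    ⟨H, hH, B, e', e'', hB, h', h'', hle⟩ | ⟨X, H, hH, rfl, B, e, e'', hB, h', h'', hle⟩
  · obtain ⟨hm, x, hx, hpar⟩ := hadd H hH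
    exact hθ.not_add hH hx hpar (hB.card_eq ▸ hm) h' h'' hle
  · exact hθ.not_del hcard hH hB (hB.card_eq ▸ hdel X H hH rfl) h' h'' hle

end Deletion

section IcosahedralFields

variable {R S : Type*} [CommRing R] [CommRing S]

/-- Linear forms vanishing on the planes orthogonal to the six five-fold axes of the icosahedron. -/
def axisForm (ω : R) : Fin 6 → Fin 3 → R :=
  ![![ω - 1, 0, 1], ![1 - ω, 0, 1], ![ω - 1, 2, 1], ![ω + 1, 2, 1], ![ω + 1, 2 * ω, 1],
    ![ω + 1, 2 * ω, 2 * ω - 1]]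

/-- Vectors spanning the six five-fold axes of the icosahedron. -/
def axisVec (ω : R) : Fin 6 → Fin 3 → R :=
  ![![1, -ω, ω], ![-1, 0, ω], ![-ω, ω, 0], ![ω, -1, 0], ![0, 1, -1], ![0, 0, 1]]

/-- The power sums of the six axis forms. -/
def powSum (ω : R) (k : ℕ) (x : Fin 3 → R) : R := ∑ i, (axisForm ω i ⬝ᵥ x) ^ k

/-- The equivariant vector fields attached to powers of the six axis forms. -/
def powVec (ω : R) (k : ℕ) (x : Fin 3 → R) : Fin 3 → R :=
  ∑ i, (axisForm ω i ⬝ᵥ x) ^ k • axisVec ω i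

/-- Coefficients of equivariant vector fields of degrees `1`, `11` and `15`. -/
def field (ω : R) (i : Fin 3) (x : Fin 3 → R) : Fin 3 → R :=
  ![x,
    (73 * powSum ω 2 x ^ 3 + 20 * powSum ω 6 x) • powVec ω 5 x - (300 * powSum ω 2 x) • powVec ω 9 x,
    (-161 * powSum ω 2 x ^ 5 + 1460 * powSum ω 2 x ^ 2 * powSum ω 6 x - 7200 * powSum ω 10 x) •
      powVec ω 5 x + (6000 * powSum ω 6 x) • powVec ω 9 x] i

lemma map_axisForm (f : R →+* S) (ω : R) (i : Fin 6) (j : Fin 3) :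
    f (axisForm ω i j) = axisForm (f ω) i j := by
  fin_cases i <;> fin_cases j <;> simp [axisForm, map_ofNat]

lemma map_axisVec (f : R →+* S) (ω : R) (i : Fin 6) (j : Fin 3) :
    f (axisVec ω i j) = axisVec (f ω) i j := by
  fin_cases i <;> fin_cases j <;> simp [axisVec]

lemma map_axisForm_dotProduct (f : R →+* S) (ω : R) (i : Fin 6) (x : Fin 3 → R) :
    f (axisForm ω i ⬝ᵥ x) = axisForm (f ω) i ⬝ᵥ (f ∘ x) := by
  simp only [dotProduct, map_sum, map_mul, map_axisForm, Function.comp_apply]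

lemma map_powSum (f : R →+* S) (ω : R) (k : ℕ) (x : Fin 3 → R) :
    f (powSum ω k x) = powSum (f ω) k (f ∘ x) := by
  simp only [powSum, map_sum, map_pow, map_axisForm_dotProduct]

lemma map_powVec (f : R →+* S) (ω : R) (k : ℕ) (x : Fin 3 → R) (j : Fin 3) :
    f (powVec ω k x j) = powVec (f ω) k (f ∘ x) j := by
  simp only [powVec, Finset.sum_apply, Pi.smul_apply, smul_eq_mul, map_sum, map_mul, map_pow,
    map_axisForm_dotProduct, map_axisVec]

lemma map_field (f : R →+* S) (ω : R) (i : Fin 3) (x : Fin 3 → R) (j : Fin 3) :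
    f (field ω i x j) = field (f ω) i (f ∘ x) j := by
  fin_cases i <;> simp [field, map_powVec, map_powSum, map_ofNat]

section Equivariance

variable {ω : R} {g : Matrix (Fin 3) (Fin 3) R} {σ : Equiv.Perm (Fin 6)} {ε : Fin 6 → R}

lemma axisForm_dotProduct_mulVec (hl : ∀ i, axisForm ω i ᵥ* g = ε i • axisForm ω (σ i)) (i : Fin 6)
    (x : Fin 3 → R) : axisForm ω i ⬝ᵥ (g *ᵥ x) = ε i * (axisForm ω (σ i) ⬝ᵥ x) := by
  rw [dotProduct_mulVec, hl, smul_dotProduct, smul_eq_mul]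

lemma powSum_mulVec (hε : ∀ i, ε i ^ 2 = 1)
    (hl : ∀ i, axisForm ω i ᵥ* g = ε i • axisForm ω (σ i)) (k : ℕ) (x : Fin 3 → R) :
    powSum ω (2 * k) (g *ᵥ x) = powSum ω (2 * k) x := by
  rw [powSum, powSum, ← Equiv.sum_comp σ fun i => (axisForm ω i ⬝ᵥ x) ^ (2 * k)]
  refine Finset.sum_congr rfl fun i _ => ?_
  rw [axisForm_dotProduct_mulVec hl, mul_pow, pow_mul, hε, one_pow, one_mul]

lemma powVec_mulVec (hε : ∀ i, ε i ^ 2 = 1)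
    (hl : ∀ i, axisForm ω i ᵥ* g = ε i • axisForm ω (σ i))
    (hu : ∀ i, g *ᵥ axisVec ω (σ i) = ε i • axisVec ω i) (k : ℕ) (x : Fin 3 → R) :
    powVec ω (2 * k + 1) (g *ᵥ x) = g *ᵥ powVec ω (2 * k + 1) x := by
  rw [powVec, powVec, Matrix.mulVec_sum,
    ← Equiv.sum_comp σ fun i => g *ᵥ (axisForm ω i ⬝ᵥ x) ^ (2 * k + 1) • axisVec ω i]
  refine Finset.sum_congr rfl fun i _ => ?_
  rw [axisForm_dotProduct_mulVec hl, Matrix.mulVec_smul, hu, smul_smul, mul_pow, pow_succ, pow_mul,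
    hε, one_pow, one_mul, mul_comm]

lemma field_mulVec (hε : ∀ i, ε i ^ 2 = 1)
    (hl : ∀ i, axisForm ω i ᵥ* g = ε i • axisForm ω (σ i))
    (hu : ∀ i, g *ᵥ axisVec ω (σ i) = ε i • axisVec ω i) (i : Fin 3) (x : Fin 3 → R) :
    field ω i (g *ᵥ x) = g *ᵥ field ω i x := by
  have h2 := powSum_mulVec hε hl 1 x
  have h6 := powSum_mulVec hε hl 3 x
  have h10 := powSum_mulVec hε hl 5 x
  have h5 := powVec_mulVec hε hl hu 2 x
  have h9 := powVec_mulVec hε hl hu 4 x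
  fin_cases i
  · rfl
  · simp only [field] at *
    simp [h2, h6, h5, h9, Matrix.mulVec_sub, Matrix.mulVec_smul]
  · simp only [field] at *
    simp [h2, h6, h10, h5, h9, Matrix.mulVec_add, Matrix.mulVec_smul]

end Equivariance

end IcosahedralFields

section Tangency

variable {R : Type*} [CommRing R]

/-- The generators of the icosahedral reflection group. -/
def gen (ω : R) : Fin 3 → Matrix (Fin 3) (Fin 3) R :=
  ![!![1, 0, 0; 0, 1, 1; 0, 0, -1], !![-1, 0, 0; ω, 1, 0; 0, 0, 1], !![1, ω, 0; 0, -1, 0; 0, 1, 1]]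

lemma field_gen_mulVec {ω : R} (hω : ω ^ 2 = ω + 1) (j i : Fin 3) (x : Fin 3 → R) :
    field ω i (gen ω j *ᵥ x) = gen ω j *ᵥ field ω i x := by
  refine field_mulVec
    (σ := ![Equiv.swap 0 1 * Equiv.swap 4 5, Equiv.swap 0 1 * Equiv.swap 2 3,
      Equiv.swap 0 2 * Equiv.swap 3 4] j)
    (ε := ![![-1, -1, 1, 1, 1, 1], 1, 1] j) ?_ ?_ ?_ i x
  · fin_cases j <;> intro i <;> fin_cases i <;> simp
  · fin_cases j <;> intro i <;> ext k <;> fin_cases i <;> fin_cases k <;>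
      simp [gen, axisForm, Equiv.swap_apply_def, Matrix.vecMul, dotProduct, Fin.sum_univ_three] <;>
      grind
  · fin_cases j <;> intro i <;> ext k <;> fin_cases i <;> fin_cases k <;>
      simp [gen, axisVec, Equiv.swap_apply_def, Matrix.mulVec, dotProduct, Fin.sum_univ_three] <;>
      grind

variable {K : Type*} [Field K] [CharZero K]

lemma field_apply_eq_zero {ω : K} (hω : ω ^ 2 = ω + 1) {i j : Fin 3} {x : Fin 3 → K} (hx : x j = 0) :
    field ω i x j = 0 := by
  have key (k : Fin 3) (hk : gen ω k *ᵥ x = x) :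
      gen ω k *ᵥ field ω i x = field ω i x := by
    rw [← field_gen_mulVec hω, hk]
  fin_cases j
  · have h := congrFun (key 1 <| by
      ext l
      simp only [Fin.zero_eta] at hx
      fin_cases l <;> simp [gen, Matrix.mulVec, dotProduct, Fin.sum_univ_three, hx]) 0
    simpa [gen, Matrix.mulVec, dotProduct, Fin.sum_univ_three, neg_eq_self] using h
  · have h := congrFun (key 2 <| by
      ext l
      simp only [Fin.mk_one] at hx
      fin_cases l <;> simp [gen, Matrix.mulVec, dotProduct, Fin.sum_univ_three, hx]) 1
    simpa [gen, Matrix.mulVec, dotProduct, Fin.sum_univ_three, neg_eq_self] using h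
  · have h := congrFun (key 0 <| by
      ext l
      simp only [Fin.reduceFinMk] at hx
      fin_cases l <;> simp [gen, Matrix.mulVec, dotProduct, Fin.sum_univ_three, hx]) 2
    simpa [gen, Matrix.mulVec, dotProduct, Fin.sum_univ_three, neg_eq_self] using h

section FiveFold

variable {ζ : K}

lemma axisForm_dotProduct_of_mem (hζ : ζ ^ 4 + ζ ^ 3 + ζ ^ 2 + ζ + 1 = 0) {x : Fin 3 → K}
    (hx : x 0 = ζ ^ 2 * x 1) : ∃ y z : K, ∀ i, axisForm (-ζ ^ 2 - ζ ^ 3) i ⬝ᵥ x =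
      ![z + ζ ^ 4 * y, z + y, z + ζ * y, z + ζ ^ 3 * y, z + ζ ^ 2 * y,
        (-2 * ζ ^ 2 - 2 * ζ ^ 3 - 1) * z] i := by
  refine ⟨(-4 - 8 * ζ - 2 * ζ ^ 2 - 6 * ζ ^ 3) * x 1 / 5, (-2 * ζ ^ 2 - 2 * ζ ^ 3 - 1) *
    (axisForm (-ζ ^ 2 - ζ ^ 3) 5 ⬝ᵥ x) / 5, fun i => ?_⟩
  fin_cases i <;> simp [axisForm, dotProduct, Fin.sum_univ_three, hx] <;> grind

lemma field_sub_eq_zero (hζ : ζ ^ 4 + ζ ^ 3 + ζ ^ 2 + ζ + 1 = 0) {x : Fin 3 → K}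
    (hx : x 0 = ζ ^ 2 * x 1) (i : Fin 3) :
    field (-ζ ^ 2 - ζ ^ 3) i x 0 = ζ ^ 2 * field (-ζ ^ 2 - ζ ^ 3) i x 1 := by
  obtain ⟨y, z, h⟩ := axisForm_dotProduct_of_mem hζ hx
  set ω := -ζ ^ 2 - ζ ^ 3 with hω
  have hp (k : ℕ) : powSum ω k x = (z + ζ ^ 4 * y) ^ k + (z + y) ^ k + (z + ζ * y) ^ k +
      (z + ζ ^ 3 * y) ^ k + (z + ζ ^ 2 * y) ^ k + ((-2 * ζ ^ 2 - 2 * ζ ^ 3 - 1) * z) ^ k := by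
    simp only [powSum, h, Fin.sum_univ_six]
    rfl
  have hv (k : ℕ) : powVec ω k x 0 - ζ ^ 2 * powVec ω k x 1 = -(ζ ^ 4 * (z + ζ ^ 4 * y) ^ k +
      (z + y) ^ k + ζ * (z + ζ * y) ^ k + ζ ^ 3 * (z + ζ ^ 3 * y) ^ k +
      ζ ^ 2 * (z + ζ ^ 2 * y) ^ k) := by
    simp only [powVec, h, Fin.sum_univ_six, axisVec]
    simp
    grind
  have h2 : powSum ω 2 x = 10 * z ^ 2 := by
    rw [hp]
    grind
  have h6 : powSum ω 6 x = 130 * z ^ 6 + 30 * y ^ 5 * z := by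
    rw [hp]
    grind
  have h10 : powSum ω 10 x = 3130 * z ^ 10 + 1260 * y ^ 5 * z ^ 5 + 5 * y ^ 10 := by
    rw [hp]
    grind
  have h5 : powVec ω 5 x 0 - ζ ^ 2 * powVec ω 5 x 1 = -25 * y ^ 4 * z := by
    rw [hv]
    grind
  have h9 : powVec ω 9 x 0 - ζ ^ 2 * powVec ω 9 x 1 = -5 * (126 * y ^ 4 * z ^ 5 + y ^ 9) := by
    rw [hv]
    grind
  fin_cases i
  · exact hx
  · simp [field, h2, h6]
    linear_combination (75600 * z ^ 6 + 600 * y ^ 5 * z) * h5 - 3000 * z ^ 2 * h9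
  · simp [field, h2, h6, h10]
    linear_combination (-161 * (10 * z ^ 2) ^ 5 + 1460 * (10 * z ^ 2) ^ 2 *
      (130 * z ^ 6 + 30 * y ^ 5 * z) - 7200 * (3130 * z ^ 10 + 1260 * y ^ 5 * z ^ 5 + 5 * y ^ 10)) *
      h5 + 6000 * (130 * z ^ 6 + 30 * y ^ 5 * z) * h9

end FiveFold

end Tangency

section SaitoFamily

variable {R : Type*} [CommRing R]

lemma dotProduct_X_isHomogeneous (ω : R) (i : Fin 6) :
    (axisForm (C ω) i ⬝ᵥ (X : Fin 3 → MvPolynomial (Fin 3) R)).IsHomogeneous 1 := by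
  refine IsHomogeneous.sum _ _ _ fun j _ => ?_
  rw [← map_axisForm]
  exact isHomogeneous_C_mul_X _ _

lemma powSum_isHomogeneous (ω : R) (k : ℕ) :
    (powSum (C ω) k (X : Fin 3 → MvPolynomial (Fin 3) R)).IsHomogeneous k :=
  IsHomogeneous.sum _ _ _ fun i _ => by
    simpa using (dotProduct_X_isHomogeneous ω i).pow k

lemma powVec_isHomogeneous (ω : R) (k : ℕ) (j : Fin 3) :
    (powVec (C ω) k (X : Fin 3 → MvPolynomial (Fin 3) R) j).IsHomogeneous k := by
  rw [powVec, Finset.sum_apply]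
  refine IsHomogeneous.sum _ _ _ fun i _ => ?_
  rw [Pi.smul_apply, smul_eq_mul, ← map_axisVec]
  simpa using ((dotProduct_X_isHomogeneous ω i).pow k).mul (isHomogeneous_C _ (axisVec ω i j))

lemma field_isHomogeneous (ω : R) (i j : Fin 3) :
    (field (C ω) i (X : Fin 3 → MvPolynomial (Fin 3) R) j).IsHomogeneous (![1, 11, 15] i) := by
  have hC (n : ℕ) [n.AtLeastTwo] : (OfNat.ofNat n : MvPolynomial (Fin 3) R).IsHomogeneous 0 := by
    rw [← map_ofNat (C : R →+* MvPolynomial (Fin 3) R)]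
    exact isHomogeneous_C _ _
  have h2 := powSum_isHomogeneous ω 2
  have h6 := powSum_isHomogeneous ω 6
  have h10 := powSum_isHomogeneous ω 10
  have h5 := powVec_isHomogeneous ω 5 j
  have h9 := powVec_isHomogeneous ω 9 j
  fin_cases i
  · exact isHomogeneous_X R j
  · exact ((((hC 73).mul (h2.pow 3)).add ((hC 20).mul h6)).mul h5).sub (((hC 300).mul h2).mul h9)
  · exact ((((((hC 161).neg.mul (h2.pow 5)).add (((hC 1460).mul (h2.pow 2)).mul h6)).sub
      ((hC 7200).mul h10)).mul h5).add (((hC 6000).mul h6).mul h9))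

variable {K : Type*} [Field K]

/-- The derivation with coefficients `field ω i`. -/
noncomputable def fieldDer (ω : K) (i : Fin 3) : Der K 3 := mkDerivation K (field (C ω) i X)

lemma fieldDer_X (ω : K) (i j : Fin 3) : fieldDer ω i (X j) = field (C ω) i X j :=
  mkDerivation_X _ _ j

lemma vf_fieldDer (ω : K) (i : Fin 3) (x : Fin 3 → K) : vf (fieldDer ω i) x = field ω i x := by
  ext j
  rw [vf, fieldDer_X, map_field]
  congr 1
  · simp
  · ext l
    simp

lemma exists_isSaitoFamily [Infinite K] {ω : K} {A : Arrangement K 3} {Q : MvPolynomial (Fin 3) K}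
    (hQ : IsDefiningPoly A Q) (hcard : A.hyperplanes.card = 27)
    (htan : ∀ i, ∀ H ∈ A.hyperplanes, ∀ x ∈ H, field ω i x ∈ H) {x : Fin 3 → K}
    (hx : (Matrix.of fun i => field ω i x).det ≠ 0) :
    ∃ c, IsSaitoFamily A Q (fieldDer ω) c := by
  have ht (i : Fin 3) : Tangent A (fieldDer ω i) := fun H hH y hy => by
    rw [vf_fieldDer]
    exact htan i H hH y hy
  have hhom (i j : Fin 3) : (fieldDer ω i (X j)).IsHomogeneous (![1, 11, 15] i) := by
    rw [fieldDer_X]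
    exact field_isHomogeneous ω i j
  have hdet : coefDet (fieldDer ω) ≠ 0 := fun h => hx <| by
    simpa [eval_coefDet, vf_fieldDer] using congrArg (eval x) h
  obtain ⟨G, hG⟩ := hQ.dvd_coefDet ht
  have hne := hdet
  rw [hG] at hne
  have hdeg : (coefDet (fieldDer ω)).IsHomogeneous 27 := coefDet_isHomogeneous hhom
  have hG0 : G.totalDegree = 0 := by
    have h1 := degree_add_of_mul hQ.isHomogeneous (hG ▸ hdeg) hne
    omega
  obtain ⟨c, rfl⟩ : ∃ c, G = C c := ⟨_, totalDegree_eq_zero_iff_eq_C.1 hG0⟩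
  refine ⟨c, hQ, ht, fun h => hne (by simp [h]), by rw [hG, mul_comm], hhom, ?_⟩
  refine der_ext fun j => ?_
  rw [fieldDer_X, euler_X]
  rfl

end SaitoFamily

/-- The ring `ℤ[ζ]` of integers of the fifth cyclotomic field, in the basis `1, ζ, ζ², ζ³`. -/
@[ext]
structure Z5 where
  a : ℤ
  b : ℤ
  c : ℤ
  d : ℤ
deriving DecidableEq

namespace Z5

instance : Zero Z5 := ⟨⟨0, 0, 0, 0⟩⟩
instance : One Z5 := ⟨⟨1, 0, 0, 0⟩⟩
instance : Add Z5 := ⟨fun x y => ⟨x.a + y.a, x.b + y.b, x.c + y.c, x.d + y.d⟩⟩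
instance : Neg Z5 := ⟨fun x => ⟨-x.a, -x.b, -x.c, -x.d⟩⟩
instance : Mul Z5 := ⟨fun x y =>
  let t := x.b * y.d + x.c * y.c + x.d * y.b
  ⟨x.a * y.a + x.c * y.d + x.d * y.c - t, x.a * y.b + x.b * y.a + x.d * y.d - t,
    x.a * y.c + x.b * y.b + x.c * y.a - t, x.a * y.d + x.b * y.c + x.c * y.b + x.d * y.a - t⟩⟩

lemma zero_def : (0 : Z5) = ⟨0, 0, 0, 0⟩ := rfl
lemma one_def : (1 : Z5) = ⟨1, 0, 0, 0⟩ := rfl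
lemma add_def (x y : Z5) : x + y = ⟨x.a + y.a, x.b + y.b, x.c + y.c, x.d + y.d⟩ := rfl
lemma neg_def (x : Z5) : -x = ⟨-x.a, -x.b, -x.c, -x.d⟩ := rfl
lemma mul_def (x y : Z5) : x * y =
    ⟨x.a * y.a + x.c * y.d + x.d * y.c - (x.b * y.d + x.c * y.c + x.d * y.b),
      x.a * y.b + x.b * y.a + x.d * y.d - (x.b * y.d + x.c * y.c + x.d * y.b),
      x.a * y.c + x.b * y.b + x.c * y.a - (x.b * y.d + x.c * y.c + x.d * y.b),
      x.a * y.d + x.b * y.c + x.c * y.b + x.d * y.a - (x.b * y.d + x.c * y.c + x.d * y.b)⟩ := rfl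

instance : CommRing Z5 where
  add_assoc x y z := by ext <;> simp only [add_def] <;> ring
  zero_add x := by ext <;> simp [add_def, zero_def]
  add_zero x := by ext <;> simp [add_def, zero_def]
  add_comm x y := by ext <;> simp only [add_def] <;> ring
  mul_assoc x y z := by ext <;> simp only [mul_def] <;> ring
  one_mul x := by ext <;> simp [mul_def, one_def]
  mul_one x := by ext <;> simp [mul_def, one_def]
  mul_comm x y := by ext <;> simp only [mul_def] <;> ring
  left_distrib x y z := by ext <;> simp only [mul_def, add_def] <;> ring
  right_distrib x y z := by ext <;> simp only [mul_def, add_def] <;> ring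
  zero_mul x := by ext <;> simp [mul_def, zero_def]
  mul_zero x := by ext <;> simp [mul_def, zero_def]
  neg_add_cancel x := by ext <;> simp [add_def, neg_def, zero_def]
  nsmul := nsmulRec
  zsmul := zsmulRec

/-- The ring homomorphism from `ℤ[ζ]` sending `ζ` to `r`. -/
def lift {R : Type*} [CommRing R] (r : R) (hr : r ^ 4 + r ^ 3 + r ^ 2 + r + 1 = 0) : Z5 →+* R where
  toFun x := x.a + x.b * r + x.c * r ^ 2 + x.d * r ^ 3
  map_zero' := by simp [zero_def]
  map_one' := by simp [one_def]
  map_add' x y := by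
    simp only [add_def, Int.cast_add]
    ring
  map_mul' x y := by
    simp only [mul_def, Int.cast_add, Int.cast_sub, Int.cast_mul]
    grind

lemma lift_apply {R : Type*} [CommRing R] {r : R} (hr : r ^ 4 + r ^ 3 + r ^ 2 + r + 1 = 0) (x : Z5) :
    lift r hr x = x.a + x.b * r + x.c * r ^ 2 + x.d * r ^ 3 := rfl

lemma lift_injective {K : Type*} [Field K] [CharZero K] {ζ : K} (hζ : IsPrimitiveRoot ζ 5)
    (h : ζ ^ 4 + ζ ^ 3 + ζ ^ 2 + ζ + 1 = 0) : Function.Injective (lift ζ h) := by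
  have hdeg : (minpoly ℚ ζ).natDegree = 4 := by
    rw [← Polynomial.cyclotomic_eq_minpoly_rat hζ (by norm_num), Polynomial.natDegree_cyclotomic]
    rfl
  have hli : LinearIndependent ℚ fun i : Fin 4 => ζ ^ (i : ℕ) := by
    have := linearIndependent_pow (K := ℚ) ζ
    rwa [hdeg] at this
  rw [injective_iff_map_eq_zero]
  intro x hx
  rw [lift_apply] at hx
  have h0 := Fintype.linearIndependent_iff.1 hli ![x.a, x.b, x.c, x.d] <| by
    simpa [Fin.sum_univ_four, Algebra.smul_def] using hx
  ext
  · simpa [zero_def] using h0 0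
  · simpa [zero_def] using h0 1
  · simpa [zero_def] using h0 2
  · simpa [zero_def] using h0 3

/-- The residue class of an element modulo the prime `(31, ζ - 2)`. -/
def residue (x : Z5) : ℤ := (x.a + 2 * x.b + 4 * x.c + 8 * x.d) % 31

end Z5

lemma two_root : (2 : ZMod 31) ^ 4 + 2 ^ 3 + 2 ^ 2 + 2 + 1 = 0 := by decide

/-- Reduction modulo the prime of `ℤ[ζ]` above `31` containing `ζ - 2`. -/
abbrev red : Z5 →+* ZMod 31 := Z5.lift 2 two_root

lemma field_det_ne_zero : (Matrix.of fun i => field (19 : ZMod 31) i ![1, 1, 1]).det ≠ 0 := by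
  rw [det_fin_three]
  decide +kernel

/-- Points of base planes at which the field of degree `11` is not radial. -/
def basePoint : Fin 4 → Fin 3 → Z5 := ![![0, 1, 1], ![1, 0, 1], ![1, 1, 0], ![⟨0, 0, 1, 0⟩, 1, ⟨2, 0, 0, 0⟩]]

lemma field_not_radial (i : Fin 4) : ∃ j k, red (basePoint i j) * field 19 1 (red ∘ basePoint i) k ≠
    red (basePoint i k) * field 19 1 (red ∘ basePoint i) j := by
  revert i
  decide +kernel

section Data

/-- Normal vectors of the planes of the arrangement. -/
def lineData : List (Fin 3 → Z5) :=
  [![⟨1, 0, 0, 0⟩, ⟨0, 0, 0, 0⟩, ⟨0, 0, 0, 0⟩],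
    ![⟨0, 0, 0, 0⟩, ⟨1, 0, 0, 0⟩, ⟨0, 0, 0, 0⟩],
    ![⟨0, 0, 0, 0⟩, ⟨0, 0, 0, 0⟩, ⟨1, 0, 0, 0⟩],
    ![⟨1, 0, 1, 0⟩, ⟨0, 1, 0, 0⟩, ⟨0, 0, 0, 0⟩],
    ![⟨0, 0, 0, 0⟩, ⟨1, 0, 0, 0⟩, ⟨1, 0, 0, 0⟩],
    ![⟨1, 1, 0, 0⟩, ⟨0, 0, 0, -1⟩, ⟨0, 0, 0, 0⟩],
    ![⟨1, 0, 1, 0⟩, ⟨0, 1, 0, 0⟩, ⟨0, 1, 0, 0⟩],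
    ![⟨1, 0, 0, 0⟩, ⟨1, 0, 0, 0⟩, ⟨0, 0, 0, 0⟩],
    ![⟨1, 1, 0, 0⟩, ⟨0, 0, 0, -1⟩, ⟨0, 0, 0, -1⟩],
    ![⟨1, 0, 0, 0⟩, ⟨1, 0, 0, 0⟩, ⟨1, 0, 0, 0⟩],
    ![⟨1, 1, 0, 0⟩, ⟨1, 1, 0, -1⟩, ⟨0, 0, 0, -1⟩],
    ![⟨1, 0, 0, 0⟩, ⟨0, 0, -1, -1⟩, ⟨1, 0, 0, 0⟩],
    ![⟨0, 1, 0, 0⟩, ⟨0, 1, 0, 0⟩, ⟨-1, 1, -1, 0⟩],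
    ![⟨0, 1, 0, 0⟩, ⟨0, 1, 0, 0⟩, ⟨1, 0, 1, 0⟩],
    ![⟨1, 1, 0, 0⟩, ⟨0, 0, 0, -2⟩, ⟨0, 0, 0, -1⟩],
    ![⟨1, 0, 0, 0⟩, ⟨0, 0, -1, 0⟩, ⟨0, 0, 0, 0⟩],
    ![⟨1, 0, 0, 0⟩, ⟨0, 0, -1, 0⟩, ⟨0, 0, -1, 0⟩],
    ![⟨1, 0, 0, 0⟩, ⟨0, 0, 0, -1⟩, ⟨0, 0, 0, 0⟩],
    ![⟨1, 0, 0, 0⟩, ⟨0, 0, 0, -1⟩, ⟨0, 0, 0, -1⟩],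
    ![⟨1, 0, 0, 0⟩, ⟨0, 0, -1, -1⟩, ⟨0, 0, -1, 0⟩],
    ![⟨1, 0, 0, 0⟩, ⟨0, 0, -1, -1⟩, ⟨0, 0, 0, -1⟩],
    ![⟨1, 0, 0, 0⟩, ⟨1, 0, 0, 0⟩, ⟨0, -1, 0, -1⟩],
    ![⟨0, 1, 0, 0⟩, ⟨0, 1, 0, 0⟩, ⟨-1, 0, 0, -1⟩],
    ![⟨1, 1, 0, 0⟩, ⟨1, 0, 0, -1⟩, ⟨1, 0, 0, 0⟩],
    ![⟨1, 1, 0, 0⟩, ⟨0, 1, 0, -1⟩, ⟨0, 1, 0, 0⟩],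
    ![⟨1, 1, 0, 0⟩, ⟨1, 0, 0, -1⟩, ⟨0, 0, 0, -1⟩],
    ![⟨1, 1, 0, 0⟩, ⟨0, 1, 0, -1⟩, ⟨0, 0, 0, -1⟩]]

/-- The `k`-th normal vector. -/
def line (k : ℕ) : Fin 3 → Z5 := lineData.getD k 0

/-- The multiple points of the arrangement: two planes through the point, and the values of all the
linear forms at the point modulo `31`, as digits in base `32`. -/
def pointData : List (ℕ × ℕ × ℕ) :=
  [(0, 1, 32287018995738449414839573099278693827584), (0, 2, 8472828890551326510797296185930364650432),
    (0, 4, 40759806347916108072576938301722639370176), (0, 10, 31949405690826818363984547118429677054208),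
    (0, 11, 12693896079324346288896725747708155842496), (0, 14, 24943842666949576214107321830438470171904),
    (0, 19, 13886059365476968343194355271922768694400), (0, 20, 23550971023509315788063275339316935019776),
    (0, 23, 73146773913560905904188055443111601088), (0, 24, 39473112641841046395550635152547329730464),
    (1, 2, 4215109227780364101031745255967603982337), (1, 6, 21090926379520582985958883356858919512066),
    (1, 8, 1510573199210005165598149169608618007), (1, 9, 15441739440430588554631164877660980705281),
    (1, 12, 9850426499450806057832862373208177275932), (1, 16, 37922294729035223556358539299319116593179),
    (1, 18, 21061898059442494792817184673032886253591), (1, 21, 12672885711086643731106670414886041188373),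
    (1, 22, 28073378804011701499327039794842082800662), (2, 3, 36318047516872994496816319156420665671869),
    (2, 5, 8302511684583899699477321171109955469416), (2, 7, 30868204847548432711482908309401649414206),
    (2, 14, 42023345266526120177192052457944852988016), (2, 15, 8387649558944959524103382339751243350052),
    (2, 17, 25248086470026840496001118620685440483368), (2, 23, 4087402456803535598445575949228252135527),
    (2, 24, 1192175090462724680586282860148396556390), (3, 4, 36813607091112975904118707090296615737154),
    (3, 8, 24914962090054248973328681797708290212143), (3, 9, 17071853978919886695898212155469432098626),
    (3, 13, 10983132591415390017862660255979004762314), (3, 16, 1910107756447514176948247390435142542999),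
    (3, 18, 23479596689123739482518099649043520049455), (3, 21, 25886510131838105003020483037541238312555),
    (3, 22, 762022681373638115922674822348539959757), (4, 5, 41982360824686110330974427688597916741736),
    (4, 7, 42094835060198657165082294118913416263742), (4, 13, 18195507121175640948923845608312438125635),
    (4, 15, 19614279732259639191667805351715172743204), (4, 17, 36474716642151859822410631430711061903400),
    (4, 21, 1304870952004555411545548603304381315124), (4, 22, 2740079359794212234867520271163245065300),
    (5, 6, 32563810978377343302852748147437436190511), (5, 9, 40940558596247611549397396397979173662615),
    (5, 10, 10128804195680878602035276251578871162626), (5, 16, 34602796403324811556730338357132718435713),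
    (5, 18, 29796320077780996580683030780742158106370), (5, 19, 848710071160385605948318650968647306625),
    (5, 20, 32698834552020223722715578896096457232130), (6, 7, 28014066797464754205378716122100910558301),
    (6, 12, 34315259551308040132725349938345232931445), (6, 15, 2762926836531825057528622393753299493960),
    (6, 17, 1253102618774992315074989491646228025424), (6, 21, 1829311103139862887335989594918677679785),
    (6, 22, 35761551206078683364813549483496594577993), (7, 8, 22158322263646110791001658556909615304983),
    (7, 11, 28135634261017502898153227106874440141761), (7, 16, 5466510640090646491589972809329951762587),
    (7, 18, 982491480630257714050818892998272866583), (7, 19, 8252252667005736429266251038811182712987),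
    (7, 20, 2416567893905250016303448681400938776855), (8, 11, 13112198533433484802909349952856539008660),
    (8, 15, 21404000248730746982507420913999923212030), (8, 17, 21408671776383808625381617106163799867133),
    (8, 19, 11068492051280567263464344660173301648541), (8, 20, 2042197205762672456693730187559955172894),
    (9, 10, 27609346457038888861247716418550760725884), (9, 15, 21048357442341233004135261491392478406692),
    (9, 17, 39260418429994332632999070756268125050920), (9, 19, 6845840407692251868024185542603773167784),
    (9, 20, 970237256343349700253240729414485133604), (10, 15, 11570242976365760679545660875179429290750),
    (10, 16, 37754997413144042207679623988812286615699), (10, 17, 11574953486810080540930411893960277668605),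
    (10, 18, 21708205069017953471413750882126161687047), (11, 15, 5601907530801870545300113063644489261092),
    (11, 16, 1130066119131450587718516945585929134261), (11, 17, 23855214826624956174539721216495627636776),
    (11, 18, 12274304676856859193437036063119704953131), (12, 15, 159795180947463831900130484354978535315),
    (12, 16, 29283720554303606913020060332348070286507), (12, 17, 38116630349786232857423887426103119099783),
    (12, 18, 12014372515196488353405526366791515125174), (13, 15, 23663560677783542015035440678726441424052),
    (13, 16, 10592472592240484233772030651544756835756), (13, 17, 23680409954454721426940634010648685851817),
    (13, 18, 38413365379601413973371226882909446321848), (14, 15, 18618258220587620525824304919294095201022),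
    (14, 16, 12487190780746043909684971290522045288577), (14, 19, 12497859250917804872359448670388045851806),
    (14, 20, 7686712615971532385130017387651687198209)]

/-- The action of the generators on the planes. -/
def actData : Fin 3 → List ℕ :=
  ![[0, 4, 2, 6, 1, 8, 3, 9, 5, 7, 11, 10, 13, 12, 14, 16, 15, 18, 17, 20, 19, 22, 21, 25, 26, 23, 24],
    [0, 5, 2, 7, 8, 1, 9, 3, 4, 6, 12, 13, 10, 11, 14, 17, 18, 15, 16, 21, 22, 19, 20, 26, 25, 24, 23],
    [3, 1, 4, 0, 2, 7, 6, 5, 10, 11, 8, 9, 12, 14, 13, 17, 19, 15, 20, 16, 18, 23, 24, 21, 22, 26, 25]]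

/-- The `k`-th digit of `r` in base `32`. -/
def digit (r k : ℕ) : ℕ := (r >>> (5 * k)) % 32

/-- The point where the planes number `p.1` and `p.2.1` meet. -/
def point (p : ℕ × ℕ × ℕ) : Fin 3 → Z5 := line p.1 ⨯₃ line p.2.1

/-- The ratio `x / y` modulo `31`, as a number at most `31`. -/
def ratio (x y : ℕ) : ℕ := x * y ^ 29 % 31 + 31 * (1 - y)

/-- The set of ratios of the digits of two numbers, as a bit mask. -/
def ratioMask (r s : ℕ) : ℕ :=
  (List.range 27).foldr (fun k m => m ||| 2 ^ ratio (digit r k) (digit s k)) 0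

/-- A test for two points: some plane contains the first one only, and either some plane contains
both or the planes meet the line through them in at least 17 points. -/
def checkPair (r s : ℕ) : Bool :=
  (List.range 27).any (fun k => digit r k == 0 && digit s k != 0) &&
  ((List.range 27).any (fun k => digit r k == 0 && digit s k == 0) ||
    Nat.ble 17 ((List.range 32).foldr (fun c n => ratioMask r s / 2 ^ c % 2 + n) 0))

lemma checkPair_pointData : (pointData.all fun p => pointData.all fun q =>
    Nat.ble q.2.2 p.2.2 || checkPair p.2.2 q.2.2) = true := by
  decide +kernel

lemma residue_pointData : (pointData.all fun p => (List.range 27).all fun k =>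
    (line k ⬝ᵥ point p).residue == digit p.2.2 k &&
      (digit p.2.2 k != 0 || line k ⬝ᵥ point p == 0)) = true := by
  decide +kernel

lemma exists_common_point : ∀ a < 27, ∀ b < 27, a ≠ b →
    ∃ p ∈ pointData, digit p.2.2 a = 0 ∧ digit p.2.2 b = 0 := by
  decide +kernel

lemma point_valid : ∀ p ∈ pointData, p.1 < 27 ∧ p.2.1 < 27 ∧ p.1 ≠ p.2.1 := by
  decide +kernel

lemma line_cross_ne_zero : ∀ a < 27, ∀ b < 27, a ≠ b → line a ⨯₃ line b ≠ 0 := by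
  decide +kernel

lemma card_points_on_line : ∀ a < 27, (pointData.filter fun p => digit p.2.2 a = 0).length ≤ 11 := by
  decide +kernel

lemma card_lines_through_point :
    ∀ p ∈ pointData, ((Finset.range 27).filter fun a => digit p.2.2 a = 0).card ≤ 7 := by
  decide +kernel

lemma actData_lt : ∀ j, ∀ a < 27, (actData j).getD a 0 < 27 := by
  decide +kernel

lemma line_vecMul_gen_cross : ∀ j, ∀ a < 27,
    (line a ᵥ* gen ⟨0, 0, -1, -1⟩ j) ⨯₃ line ((actData j).getD a 0) = 0 := by
  decide +kernel

lemma line_reachable : ∀ a < 27, a ∈ [0, 1, 2, 15] ∨ ∃ j, ∃ b < a, (actData j).getD b 0 = a := by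
  decide +kernel

end Data

section Cross

variable {K : Type*} [Field K] {v w x y a b : Fin 3 → K}

lemma mem_perp {n : ℕ} {v x : Fin n → K} : x ∈ perp v ↔ v ⬝ᵥ x = 0 := by
  simp [perp, lf, dotProduct, LinearMap.mem_ker, LinearMap.sum_apply]

lemma ker_eq_perp {n : ℕ} (f : (Fin n → K) →ₗ[K] K) :
    LinearMap.ker f = perp fun i => f (Pi.single i 1) := by
  ext x
  rw [mem_perp, LinearMap.mem_ker, linearForm_apply]
  simp [dotProduct, mul_comm]

lemma exists_eq_smul_of_cross_eq_zero (hv : v ≠ 0) (h : v ⨯₃ w = 0) : ∃ s : K, w = s • v := by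
  obtain ⟨i, hi⟩ := Function.ne_iff.1 hv
  have h' (u : Fin 3 → K) : (u ⬝ᵥ w) • v = (u ⬝ᵥ v) • w := by
    rw [← sub_eq_zero, dotProduct_comm u v, ← cross_cross_eq_smul_sub_smul', h, map_zero]
  have hi' := h' (Pi.single i 1)
  simp only [single_dotProduct, one_mul] at hi'
  refine ⟨(v i)⁻¹ * w i, ?_⟩
  rw [mul_smul, hi', smul_smul, inv_mul_cancel₀ hi, one_smul]

lemma dotProduct_eq_zero_of_cross_eq_zero (hv : v ≠ 0) (h : v ⨯₃ w = 0) (hx : v ⬝ᵥ x = 0) :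
    w ⬝ᵥ x = 0 := by
  obtain ⟨s, rfl⟩ := exists_eq_smul_of_cross_eq_zero hv h
  rw [smul_dotProduct, hx, smul_zero]

lemma cross_eq_zero_comm : v ⨯₃ w = 0 ↔ w ⨯₃ v = 0 := by
  rw [← cross_anticomm, neg_eq_zero]

lemma perp_eq_perp_iff (hv : v ≠ 0) (hw : w ≠ 0) : perp v = perp w ↔ v ⨯₃ w = 0 := by
  refine ⟨fun h => ?_, fun h => ?_⟩
  · have h' (u : Fin 3 → K) : u ⬝ᵥ v ⨯₃ w = 0 := by
      have h1 : u ⨯₃ v ∈ perp w := by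
        rw [← h, mem_perp, dot_cross_self]
      rw [triple_product_permutation, triple_product_permutation]
      exact mem_perp.1 h1
    ext i
    simpa using h' (Pi.single i 1)
  · ext x
    rw [mem_perp, mem_perp]
    exact ⟨dotProduct_eq_zero_of_cross_eq_zero hv h,
      dotProduct_eq_zero_of_cross_eq_zero hw (cross_eq_zero_comm.1 h)⟩

lemma cross_eq_zero_of_orthogonal (hab : a ⨯₃ b ≠ 0) (hax : a ⬝ᵥ x = 0) (hbx : b ⬝ᵥ x = 0)
    (hay : a ⬝ᵥ y = 0) (hby : b ⬝ᵥ y = 0) : x ⨯₃ y = 0 := by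
  have key {z : Fin 3 → K} (haz : a ⬝ᵥ z = 0) (hbz : b ⬝ᵥ z = 0) : ∃ s : K, z = s • a ⨯₃ b := by
    refine exists_eq_smul_of_cross_eq_zero hab (cross_eq_zero_comm.1 ?_)
    rw [cross_cross_eq_smul_sub_smul', dotProduct_comm z b, haz, hbz, zero_smul, zero_smul,
      sub_zero]
  obtain ⟨s, rfl⟩ := key hax hbx
  obtain ⟨t, rfl⟩ := key hay hby
  simp [cross_self]

lemma map_cross {R S : Type*} [CommRing R] [CommRing S] (f : R →+* S) (v w : Fin 3 → R) :
    f ∘ (v ⨯₃ w) = (f ∘ v) ⨯₃ (f ∘ w) := by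
  ext i
  fin_cases i <;> simp [cross_apply]

end Cross

section Counting

lemma card_image_le_of_factors {ι α β : Type*} [DecidableEq α] [DecidableEq β] {s : Finset ι}
    {f : ι → α} {g : ι → β} (h : ∀ i ∈ s, ∀ j ∈ s, f i = f j → g i = g j) :
    (s.image g).card ≤ (s.image f).card := by
  refine Finset.card_le_card_of_forall_subsingleton (fun y x => ∃ i ∈ s, g i = y ∧ f i = x) ?_ ?_
  · intro y hy
    obtain ⟨i, hi, rfl⟩ := Finset.mem_image.1 hy
    exact ⟨f i, Finset.mem_image_of_mem f hi, i, hi, rfl, rfl⟩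
  · rintro x - _ ⟨-, i, hi, rfl, rfl⟩ _ ⟨-, j, hj, rfl, hij⟩
    exact h i hi j hj hij.symm

instance : Fact (Nat.Prime 31) := ⟨by norm_num⟩

lemma natCast_ne_zero_of_lt {y : ℕ} (hy : y < 31) (hy0 : y ≠ 0) : (y : ZMod 31) ≠ 0 := by
  rw [Ne, ZMod.natCast_eq_zero_iff]
  exact Nat.not_dvd_of_pos_of_lt (Nat.pos_of_ne_zero hy0) hy

lemma ratio_eq_ratio {x y x' y' : ℕ} (hx : x < 31) (hy : y < 31) (hx' : x' < 31) (hy' : y' < 31)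
    (h0 : ¬ (x = 0 ∧ y = 0)) (h0' : ¬ (x' = 0 ∧ y' = 0))
    (h : (y * x' : ZMod 31) = x * y') : ratio x y = ratio x' y' := by
  by_cases hy0 : y = 0
  · have hx0 : x ≠ 0 := fun h => h0 ⟨h, hy0⟩
    have hy0' : y' = 0 := by
      by_contra hne
      rw [hy0, Nat.cast_zero, zero_mul] at h
      exact mul_ne_zero (natCast_ne_zero_of_lt hx hx0) (natCast_ne_zero_of_lt hy' hne) h.symm
    simp [ratio, hy0, hy0']
  · have hy0' : y' ≠ 0 := by
      intro hy0'
      have hx0' : x' ≠ 0 := fun h => h0' ⟨h, hy0'⟩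
      rw [hy0', Nat.cast_zero, mul_zero] at h
      exact mul_ne_zero (natCast_ne_zero_of_lt hy hy0) (natCast_ne_zero_of_lt hx' hx0') h
    have h1 : (y : ZMod 31) ^ 30 = 1 := ZMod.pow_card_sub_one_eq_one (natCast_ne_zero_of_lt hy hy0)
    have h1' : (y' : ZMod 31) ^ 30 = 1 :=
      ZMod.pow_card_sub_one_eq_one (natCast_ne_zero_of_lt hy' hy0')
    have h2 : x * y ^ 29 ≡ x' * y' ^ 29 [MOD 31] := by
      rw [← ZMod.natCast_eq_natCast_iff]
      push_cast
      linear_combination (-(x * y ^ 29 : ZMod 31)) * h1' - (y ^ 29 * y' ^ 29 : ZMod 31) * h +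
        (x' * y' ^ 29 : ZMod 31) * h1
    rw [ratio, ratio, h2, Nat.sub_eq_zero_of_le (Nat.one_le_iff_ne_zero.2 hy0),
      Nat.sub_eq_zero_of_le (Nat.one_le_iff_ne_zero.2 hy0')]

lemma testBit_foldr_two_pow (ρ : ℕ → ℕ) (l : List ℕ) (c : ℕ) :
    (l.foldr (fun k m => m ||| 2 ^ ρ k) 0).testBit c = true ↔ ∃ k ∈ l, ρ k = c := by
  induction l with
  | nil => simp
  | cons k l ih => simp [Nat.testBit_or, Nat.testBit_two_pow, ih, or_comm]

lemma foldr_bits_le_card {m : ℕ} {s : Finset ℕ} (h : ∀ c, m.testBit c = true → c ∈ s) (l : List ℕ)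
    (hl : l.Nodup) : l.foldr (fun c n => m / 2 ^ c % 2 + n) 0 ≤ (s ∩ l.toFinset).card := by
  induction l with
  | nil => simp
  | cons c l ih =>
    rw [List.nodup_cons] at hl
    have ih := ih hl.2
    rw [List.foldr_cons, List.toFinset_cons]
    by_cases hc : m.testBit c = true
    · rw [Finset.inter_insert_of_mem (h c hc), Finset.card_insert_of_notMem (by simp [hl.1])]
      have := Nat.mod_lt (m / 2 ^ c) two_pos
      omega
    · rw [Nat.testBit_eq_decide_div_mod_eq] at hc
      have h2 : (s ∩ l.toFinset).card ≤ (s ∩ insert c l.toFinset).card :=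
        Finset.card_le_card (Finset.inter_subset_inter_left (Finset.subset_insert _ _))
      simp only [decide_eq_true_eq] at hc
      have := Nat.mod_lt (m / 2 ^ c) two_pos
      omega

lemma le_card_image_ratio {r s : ℕ}
    (h : 17 ≤ (List.range 32).foldr (fun c n => ratioMask r s / 2 ^ c % 2 + n) 0) :
    17 ≤ ((Finset.range 27).image fun k => ratio (digit r k) (digit s k)).card := by
  refine h.trans ((foldr_bits_le_card (s := (Finset.range 27).image fun k =>
    ratio (digit r k) (digit s k)) (fun c hc => ?_) _ List.nodup_range).trans
    (Finset.card_le_card Finset.inter_subset_left))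
  obtain ⟨k, hk, rfl⟩ := (testBit_foldr_two_pow _ _ _).1 hc
  exact Finset.mem_image_of_mem (fun k => ratio (digit r k) (digit s k)) (by simpa using hk)

end Counting

section Planes

variable {K : Type*} [Field K] {ψ : Z5 →+* K}

/-- The planes of the arrangement over a field containing the image of `ℤ[ζ]` under `ψ`. -/
noncomputable def planes (ψ : Z5 →+* K) : Finset (Submodule K (Fin 3 → K)) :=
  (Finset.range 27).image fun k => perp (ψ ∘ line k)

lemma red_eq_residue (x : Z5) : red x = (x.residue : ZMod 31) := by
  rw [Z5.lift_apply, Z5.residue]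
  have h := ZMod.intCast_mod (x.a + 2 * x.b + 4 * x.c + 8 * x.d) 31
  rw [Nat.cast_ofNat] at h
  rw [h]
  push_cast
  ring

section Digits

variable {p : ℕ × ℕ × ℕ} {k : ℕ}

lemma residue_eq_digit (hp : p ∈ pointData) (hk : k < 27) :
    (line k ⬝ᵥ point p).residue = digit p.2.2 k := by
  have h := List.all_eq_true.1 (List.all_eq_true.1 residue_pointData p hp) k (List.mem_range.2 hk)
  rw [Bool.and_eq_true] at h
  exact beq_iff_eq.1 h.1

lemma red_dotProduct (hp : p ∈ pointData) (hk : k < 27) :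
    red (line k ⬝ᵥ point p) = digit p.2.2 k := by
  rw [red_eq_residue, residue_eq_digit hp hk, Int.cast_natCast]

lemma digit_lt (hp : p ∈ pointData) (hk : k < 27) : digit p.2.2 k < 31 := by
  have h := residue_eq_digit hp hk
  have h' := Int.emod_lt_of_pos ((line k ⬝ᵥ point p).a + 2 * (line k ⬝ᵥ point p).b +
    4 * (line k ⬝ᵥ point p).c + 8 * (line k ⬝ᵥ point p).d) (show (0 : ℤ) < 31 by norm_num)
  rw [Z5.residue] at h
  omega

lemma dotProduct_eq_zero (hp : p ∈ pointData) (hk : k < 27) (h : digit p.2.2 k = 0) :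
    line k ⬝ᵥ point p = 0 := by
  have h' := List.all_eq_true.1 (List.all_eq_true.1 residue_pointData p hp) k (List.mem_range.2 hk)
  rw [Bool.and_eq_true] at h'
  simpa [h] using h'.2

lemma map_dotProduct_eq_zero_iff (hψ : Function.Injective ψ) (hp : p ∈ pointData) (hk : k < 27) :
    (ψ ∘ line k) ⬝ᵥ (ψ ∘ point p) = 0 ↔ digit p.2.2 k = 0 := by
  rw [← RingHom.map_dotProduct, map_eq_zero_iff ψ hψ]
  refine ⟨fun h => ?_, dotProduct_eq_zero hp hk⟩
  have h' := residue_eq_digit hp hk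
  rw [h, show Z5.residue 0 = 0 by decide] at h'
  exact_mod_cast h'.symm

end Digits

lemma comp_ne_zero (hψ : Function.Injective ψ) {v : Fin 3 → Z5} (hv : v ≠ 0) : ψ ∘ v ≠ 0 := by
  contrapose! hv
  ext1 i
  exact hψ (by simpa using congrFun hv i)

lemma map_line_cross_ne_zero (hψ : Function.Injective ψ) {a b : ℕ} (ha : a < 27) (hb : b < 27)
    (hab : a ≠ b) : (ψ ∘ line a) ⨯₃ (ψ ∘ line b) ≠ 0 := by
  rw [← map_cross]
  exact comp_ne_zero hψ (line_cross_ne_zero a ha b hb hab)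

lemma map_line_ne_zero (hψ : Function.Injective ψ) {a : ℕ} (ha : a < 27) : ψ ∘ line a ≠ 0 := by
  intro h
  obtain ⟨b, hb, hab⟩ : ∃ b < 27, a ≠ b := ⟨if a = 0 then 1 else 0, by split <;> omega, by split <;> omega⟩
  exact map_line_cross_ne_zero hψ ha hb hab (by rw [h, map_zero, LinearMap.zero_apply])

lemma map_point_ne_zero (hψ : Function.Injective ψ) {p : ℕ × ℕ × ℕ} (hp : p ∈ pointData) :
    ψ ∘ point p ≠ 0 := by
  obtain ⟨h1, h2, h3⟩ := point_valid p hp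
  exact comp_ne_zero hψ (line_cross_ne_zero _ h1 _ h2 h3)

lemma perp_line_injOn (hψ : Function.Injective ψ) :
    Set.InjOn (fun k => perp (ψ ∘ line k)) (Finset.range 27) := by
  intro a ha b hb h
  rw [Finset.mem_coe, Finset.mem_range] at ha hb
  by_contra hab
  exact map_line_cross_ne_zero hψ ha hb hab
    ((perp_eq_perp_iff (map_line_ne_zero hψ ha) (map_line_ne_zero hψ hb)).1 h)

lemma card_planes (hψ : Function.Injective ψ) : (planes ψ).card = 27 := by
  rw [planes, Finset.card_image_of_injOn (perp_line_injOn hψ), Finset.card_range]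

lemma perp_inf_perp_eq_span {a b x : Fin 3 → K} (hab : a ⨯₃ b ≠ 0) (hx : x ≠ 0) (hax : a ⬝ᵥ x = 0)
    (hbx : b ⬝ᵥ x = 0) : perp a ⊓ perp b = K ∙ x := by
  ext y
  rw [Submodule.mem_inf, mem_perp, mem_perp, Submodule.mem_span_singleton]
  constructor
  · rintro ⟨hay, hby⟩
    obtain ⟨s, rfl⟩ := exists_eq_smul_of_cross_eq_zero hx
      (cross_eq_zero_of_orthogonal hab hax hbx hay hby)
    exact ⟨s, rfl⟩
  · rintro ⟨s, rfl⟩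
    rw [dotProduct_smul, dotProduct_smul, hax, hbx, smul_zero]
    exact ⟨rfl, rfl⟩

/-- Each plane meets the others in at most 11 lines. -/
lemma card_traces_le (hψ : Function.Injective ψ) {A : Arrangement K 3} (hA : A.hyperplanes = planes ψ)
    {H : Submodule K (Fin 3 → K)} (hH : H ∈ A.hyperplanes) : (traces A H).card ≤ 11 := by
  rw [hA, planes] at hH
  obtain ⟨a, ha, rfl⟩ := Finset.mem_image.1 hH
  rw [Finset.mem_range] at ha
  have hsub : traces A (perp (ψ ∘ line a)) ⊆
      (pointData.filter fun p => digit p.2.2 a = 0).toFinset.image fun p => K ∙ (ψ ∘ point p) := by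
    intro T hT
    rw [traces, hA, planes] at hT
    obtain ⟨H', hH', rfl⟩ := Finset.mem_image.1 hT
    obtain ⟨hne, hH'⟩ := Finset.mem_erase.1 hH'
    obtain ⟨b, hb, rfl⟩ := Finset.mem_image.1 hH'
    rw [Finset.mem_range] at hb
    have hab : a ≠ b := by
      rintro rfl
      exact hne rfl
    obtain ⟨p, hp, hpa, hpb⟩ := exists_common_point a ha b hb hab
    refine Finset.mem_image.2 ⟨p, by simpa using ⟨hp, hpa⟩, ?_⟩
    exact (perp_inf_perp_eq_span (map_line_cross_ne_zero hψ ha hb hab) (map_point_ne_zero hψ hp)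
      ((map_dotProduct_eq_zero_iff hψ hp ha).2 hpa) ((map_dotProduct_eq_zero_iff hψ hp hb).2 hpb)).symm
  exact (Finset.card_le_card hsub).trans (Finset.card_image_le.trans
    ((List.toFinset_card_le _).trans (by simpa using card_points_on_line a ha)))

section NewPlane

variable {v : Fin 3 → K}

lemma exists_point_of_inf_eq (hψ : Function.Injective ψ) {a b : ℕ}
    (hva : v ⨯₃ (ψ ∘ line a) ≠ 0) (ha : a < 27) (hb : b < 27) (hab : a ≠ b)
    (h : perp v ⊓ perp (ψ ∘ line a) = perp v ⊓ perp (ψ ∘ line b)) :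
    ∃ p ∈ pointData, digit p.2.2 a = 0 ∧ digit p.2.2 b = 0 ∧ v ⬝ᵥ (ψ ∘ point p) = 0 := by
  obtain ⟨p, hp, hpa, hpb⟩ := exists_common_point a ha b hb hab
  refine ⟨p, hp, hpa, hpb, ?_⟩
  have hw : v ⨯₃ (ψ ∘ line a) ∈ perp v ⊓ perp (ψ ∘ line b) := by
    rw [← h]
    exact ⟨mem_perp.2 (dot_self_cross _ _), mem_perp.2 (dot_cross_self _ _)⟩
  have h0 := cross_eq_zero_of_orthogonal (map_line_cross_ne_zero hψ ha hb hab)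
    (dot_cross_self _ _) (mem_perp.1 hw.2) ((map_dotProduct_eq_zero_iff hψ hp ha).2 hpa)
    ((map_dotProduct_eq_zero_iff hψ hp hb).2 hpb)
  rw [dotProduct_comm]
  exact dotProduct_eq_zero_of_cross_eq_zero hva h0 (by rw [dotProduct_comm, dot_self_cross])

lemma ratio_eq_of_inf_eq (hψ : Function.Injective ψ) {p q : ℕ × ℕ × ℕ} (hp : p ∈ pointData)
    (hq : q ∈ pointData) (hvp : v ⬝ᵥ (ψ ∘ point p) = 0) (hvq : v ⬝ᵥ (ψ ∘ point q) = 0)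
    (h0 : ∀ k < 27, ¬ (digit p.2.2 k = 0 ∧ digit q.2.2 k = 0)) {a b : ℕ} (ha : a < 27) (hb : b < 27)
    (h : perp v ⊓ perp (ψ ∘ line a) = perp v ⊓ perp (ψ ∘ line b)) :
    ratio (digit p.2.2 a) (digit q.2.2 a) = ratio (digit p.2.2 b) (digit q.2.2 b) := by
  set w := ψ (line a ⬝ᵥ point q) • (ψ ∘ point p) - ψ (line a ⬝ᵥ point p) • (ψ ∘ point q) with hw
  have hdot (k : ℕ) : (ψ ∘ line k) ⬝ᵥ w = ψ (line a ⬝ᵥ point q * (line k ⬝ᵥ point p) -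
      line a ⬝ᵥ point p * (line k ⬝ᵥ point q)) := by
    rw [hw, dotProduct_sub, dotProduct_smul, dotProduct_smul, ← RingHom.map_dotProduct,
      ← RingHom.map_dotProduct, smul_eq_mul, smul_eq_mul, map_sub, map_mul, map_mul]
  have hmem : w ∈ perp v ⊓ perp (ψ ∘ line a) := by
    refine ⟨mem_perp.2 ?_, mem_perp.2 ?_⟩
    · rw [hw, dotProduct_sub, dotProduct_smul, dotProduct_smul, hvp, hvq, smul_zero, smul_zero,
        sub_zero]
    · rw [hdot, mul_comm, sub_self, map_zero]
  rw [h] at hmem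
  have hb0 := mem_perp.1 hmem.2
  rw [hdot, map_eq_zero_iff ψ hψ, sub_eq_zero] at hb0
  refine ratio_eq_ratio (digit_lt hp ha) (digit_lt hq ha) (digit_lt hp hb) (digit_lt hq hb)
    (h0 a ha) (h0 b hb) ?_
  rw [← red_dotProduct hp ha, ← red_dotProduct hp hb, ← red_dotProduct hq ha, ← red_dotProduct hq hb,
    ← map_mul, ← map_mul, hb0]

lemma card_image_inf_of_row_lt (hψ : Function.Injective ψ)
    (hv : ∀ k < 27, v ⨯₃ (ψ ∘ line k) ≠ 0) {p q : ℕ × ℕ × ℕ} (hp : p ∈ pointData)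
    (hq : q ∈ pointData) (hvp : v ⬝ᵥ (ψ ∘ point p) = 0) (hvq : v ⬝ᵥ (ψ ∘ point q) = 0)
    (hpq : p.2.2 < q.2.2) :
    17 ≤ ((Finset.range 27).image fun k => perp v ⊓ perp (ψ ∘ line k)).card := by
  have h := List.all_eq_true.1 (List.all_eq_true.1 checkPair_pointData p hp) q hq
  have hle : Nat.ble q.2.2 p.2.2 = false := by
    rw [← Bool.not_eq_true, Nat.ble_eq]
    omega
  rw [hle, Bool.false_or, checkPair, Bool.and_eq_true, Bool.or_eq_true, List.any_eq_true,
    List.any_eq_true] at h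
  obtain ⟨⟨k, hk, hkpq⟩, h⟩ := h
  simp only [List.mem_range, Bool.and_eq_true, beq_iff_eq, bne_iff_ne] at hk hkpq h
  have h0 : ∀ k < 27, ¬ (digit p.2.2 k = 0 ∧ digit q.2.2 k = 0) := by
    rintro l hl ⟨hlp, hlq⟩
    have hc := cross_eq_zero_of_orthogonal (hv l hl) hvp
      ((map_dotProduct_eq_zero_iff hψ hp hl).2 hlp) hvq
      ((map_dotProduct_eq_zero_iff hψ hq hl).2 hlq)
    refine hkpq.2 ((map_dotProduct_eq_zero_iff hψ hq hk).1 ?_)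
    rw [dotProduct_comm]
    refine dotProduct_eq_zero_of_cross_eq_zero (map_point_ne_zero hψ hp) hc ?_
    rw [dotProduct_comm]
    exact (map_dotProduct_eq_zero_iff hψ hp hk).2 hkpq.1
  obtain ⟨l, hl, hl0⟩ | h := h
  · exact absurd hl0 (h0 l hl)
  · refine (le_card_image_ratio (Nat.le_of_ble_eq_true h)).trans (card_image_le_of_factors ?_)
    intro a ha b hb hab
    exact ratio_eq_of_inf_eq hψ hp hq hvp hvq h0 (Finset.mem_range.1 ha) (Finset.mem_range.1 hb) hab

lemma card_image_inf (hψ : Function.Injective ψ) (hv : ∀ k < 27, v ⨯₃ (ψ ∘ line k) ≠ 0) :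
    17 ≤ ((Finset.range 27).image fun k => perp v ⊓ perp (ψ ∘ line k)).card := by
  by_cases hrow : ∃ p ∈ pointData, ∃ q ∈ pointData, v ⬝ᵥ (ψ ∘ point p) = 0 ∧
      v ⬝ᵥ (ψ ∘ point q) = 0 ∧ p.2.2 < q.2.2
  · obtain ⟨p, hp, q, hq, hvp, hvq, hpq⟩ := hrow
    exact card_image_inf_of_row_lt hψ hv hp hq hvp hvq hpq
  have hrow' {p q : ℕ × ℕ × ℕ} (hp : p ∈ pointData) (hq : q ∈ pointData)
      (hvp : v ⬝ᵥ (ψ ∘ point p) = 0) (hvq : v ⬝ᵥ (ψ ∘ point q) = 0) : p.2.2 = q.2.2 := by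
    refine le_antisymm (not_lt.1 fun h => hrow ?_) (not_lt.1 fun h => hrow ?_)
    exacts [⟨q, hq, p, hp, hvq, hvp, h⟩, ⟨p, hp, q, hq, hvp, hvq, h⟩]
  obtain ⟨s, hs, hcard, hsp⟩ : ∃ s ⊆ Finset.range 27, 17 ≤ s.card ∧ ∀ a ∈ s, ∀ p ∈ pointData,
      v ⬝ᵥ (ψ ∘ point p) = 0 → digit p.2.2 a ≠ 0 := by
    by_cases hex : ∃ p ∈ pointData, v ⬝ᵥ (ψ ∘ point p) = 0
    · obtain ⟨p, hp, hvp⟩ := hex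
      refine ⟨(Finset.range 27).filter fun a => ¬ digit p.2.2 a = 0, Finset.filter_subset _ _, ?_,
        fun a ha q hq hvq => ?_⟩
      · have h1 := card_lines_through_point p hp
        have h2 := Finset.card_filter_add_card_filter_not (s := Finset.range 27) fun a => digit p.2.2 a = 0
        rw [Finset.card_range] at h2
        convert (show 17 ≤ _ by omega : 17 ≤ ((Finset.range 27).filter fun a => ¬ digit p.2.2 a = 0).card)
      · rw [hrow' hq hp hvq hvp]
        exact (Finset.mem_filter.1 ha).2
    · exact ⟨Finset.range 27, subset_rfl, by simp, fun a _ p hp hvp => (hex ⟨p, hp, hvp⟩).elim⟩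
  refine (hcard.trans_eq (Finset.card_image_of_injOn ?_).symm).trans
    (Finset.card_le_card (Finset.image_subset_image hs))
  intro a ha b hb hab
  by_contra hne
  have ha' := Finset.mem_range.1 (hs ha)
  obtain ⟨p, hp, hpa, -, hvp⟩ := exists_point_of_inf_eq hψ (hv a ha') ha'
    (Finset.mem_range.1 (hs hb)) hne hab
  exact hsp a ha p hp hvp hpa

/-- Each further plane meets the planes of the arrangement in at least 17 lines. -/
lemma le_card_traces (hψ : Function.Injective ψ) {A X : Arrangement K 3}
    (hA : A.hyperplanes = planes ψ) {H : Submodule K (Fin 3 → K)} (hH : H ∈ X.hyperplanes)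
    (hX : A = X.delete H) : 17 ≤ (traces X H).card := by
  have hX' : X.hyperplanes.erase H = planes ψ := by
    rw [← hA, hX]
    rfl
  obtain ⟨f, hf, hHf⟩ := X.isHyp H hH
  rw [ker_eq_perp] at hHf
  have hv : (fun i => f (Pi.single i 1)) ≠ 0 := by
    intro h
    refine hf (LinearMap.ext fun x => ?_)
    rw [linearForm_apply]
    simp only [funext_iff, Pi.zero_apply] at h
    simp [h]
  have hcard := card_image_inf hψ (v := fun i => f (Pi.single i 1)) fun k hk h => by
    rw [← perp_eq_perp_iff hv (map_line_ne_zero hψ hk), ← hHf] at h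
    refine Finset.notMem_erase H X.hyperplanes ?_
    rw [hX', h]
    exact Finset.mem_image_of_mem (fun k => perp (ψ ∘ line k)) (Finset.mem_range.2 hk)
  rw [← hHf] at hcard
  rw [traces, hX', planes, Finset.image_image]
  exact hcard

end NewPlane

end Planes

section Orbit

variable {K : Type*} [Field K]

/-- The pullback of a subspace along an invertible matrix. -/
noncomputable def pull (g : GL (Fin 3) K) (H : Submodule K (Fin 3 → K)) : Submodule K (Fin 3 → K) :=
  H.comap (g : Matrix (Fin 3) (Fin 3) K).mulVecLin

lemma mem_pull {g : GL (Fin 3) K} {H : Submodule K (Fin 3 → K)} {x : Fin 3 → K} :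
    x ∈ pull g H ↔ (g : Matrix (Fin 3) (Fin 3) K) *ᵥ x ∈ H := Iff.rfl

lemma pull_one (H : Submodule K (Fin 3 → K)) : pull 1 H = H := by
  ext x
  simp [mem_pull]

lemma pull_mul (g h : GL (Fin 3) K) (H : Submodule K (Fin 3 → K)) :
    pull (g * h) H = pull h (pull g H) := by
  ext x
  simp [mem_pull, Matrix.mulVec_mulVec]

lemma pull_injective (g : GL (Fin 3) K) : Function.Injective (pull g) :=
  Function.LeftInverse.injective (g := pull g⁻¹) fun H => by rw [← pull_mul, mul_inv_cancel, pull_one]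

lemma pull_perp (g : GL (Fin 3) K) (v : Fin 3 → K) :
    pull g (perp v) = perp (v ᵥ* (g : Matrix (Fin 3) (Fin 3) K)) := by
  ext x
  rw [mem_pull, mem_perp, mem_perp, dotProduct_mulVec]

lemma vecMul_ne_zero (g : GL (Fin 3) K) {v : Fin 3 → K} (hv : v ≠ 0) :
    v ᵥ* (g : Matrix (Fin 3) (Fin 3) K) ≠ 0 := fun h =>
  hv (Matrix.vecMul_injective_of_isUnit g.isUnit (h.trans (Matrix.zero_vecMul _).symm))

lemma map_gen {R S : Type*} [CommRing R] [CommRing S] (f : R →+* S) (ω : R) (j : Fin 3) :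
    (gen ω j).map f = gen (f ω) j := by
  ext i k
  fin_cases j <;> fin_cases i <;> fin_cases k <;> simp [gen]

variable {ψ : Z5 →+* K} {g : Fin 3 → GL (Fin 3) K}

lemma pull_gen_line (hψ : Function.Injective ψ)
    (hg : ∀ j, (g j : Matrix (Fin 3) (Fin 3) K) = gen (ψ ⟨0, 0, -1, -1⟩) j) (j : Fin 3) {a : ℕ}
    (ha : a < 27) :
    pull (g j) (perp (ψ ∘ line a)) = perp (ψ ∘ line ((actData j).getD a 0)) := by
  have h : (ψ ∘ line a) ᵥ* (g j : Matrix (Fin 3) (Fin 3) K) =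
      ψ ∘ (line a ᵥ* gen ⟨0, 0, -1, -1⟩ j) := by
    ext i
    rw [hg, ← map_gen, Function.comp_apply, RingHom.map_vecMul]
  rw [pull_perp, perp_eq_perp_iff (vecMul_ne_zero _ (map_line_ne_zero hψ ha))
    (map_line_ne_zero hψ (actData_lt j a ha)), h, ← map_cross, line_vecMul_gen_cross j a ha]
  ext
  simp

lemma pull_mem_planes (hψ : Function.Injective ψ)
    (hg : ∀ j, (g j : Matrix (Fin 3) (Fin 3) K) = gen (ψ ⟨0, 0, -1, -1⟩) j) {w : GL (Fin 3) K}
    (hw : w ∈ Subgroup.closure (Set.range g)) : ∀ H ∈ planes ψ, pull w H ∈ planes ψ := by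
  induction hw using Subgroup.closure_induction with
  | mem w hw =>
    obtain ⟨j, rfl⟩ := hw
    intro H hH
    obtain ⟨a, ha, rfl⟩ := Finset.mem_image.1 hH
    rw [Finset.mem_range] at ha
    rw [pull_gen_line hψ hg j ha]
    exact Finset.mem_image_of_mem (fun k => perp (ψ ∘ line k))
      (Finset.mem_range.2 (actData_lt j a ha))
  | one =>
    intro H hH
    rwa [pull_one]
  | mul w w' _ _ hw hw' =>
    intro H hH
    rw [pull_mul]
    exact hw' _ (hw _ hH)
  | inv w _ hw =>
    intro H hH
    have himage : (planes ψ).image (pull w) = planes ψ :=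
      Finset.eq_of_subset_of_card_le (Finset.image_subset_iff.2 hw)
        (by rw [Finset.card_image_of_injective _ (pull_injective w)])
    rw [← himage] at hH
    obtain ⟨H', hH', rfl⟩ := Finset.mem_image.1 hH
    rw [← pull_mul, mul_inv_cancel, pull_one]
    exact hH'

/-- Numbers of representatives of the orbits of planes. -/
def baseIndex : Fin 4 → ℕ := ![0, 1, 2, 15]

lemma baseIndex_lt (b : Fin 4) : baseIndex b < 27 := by
  revert b
  decide

lemma mem_planes_iff (hψ : Function.Injective ψ)
    (hg : ∀ j, (g j : Matrix (Fin 3) (Fin 3) K) = gen (ψ ⟨0, 0, -1, -1⟩) j)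
    {H : Submodule K (Fin 3 → K)} : H ∈ planes ψ ↔
      ∃ w ∈ Subgroup.closure (Set.range g), ∃ b, H = pull w (perp (ψ ∘ line (baseIndex b))) := by
  constructor
  · intro hH
    obtain ⟨a, ha, rfl⟩ := Finset.mem_image.1 hH
    rw [Finset.mem_range] at ha
    clear hH
    induction a using Nat.strong_induction_on with
    | _ a ih =>
      obtain h | ⟨j, b, hba, hb⟩ := line_reachable a ha
      · obtain ⟨b, rfl⟩ : ∃ b, a = baseIndex b := by
          simp only [List.mem_cons, List.not_mem_nil, or_false] at h
          obtain rfl | rfl | rfl | rfl := h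
          exacts [⟨0, rfl⟩, ⟨1, rfl⟩, ⟨2, rfl⟩, ⟨3, rfl⟩]
        exact ⟨1, one_mem _, b, (pull_one _).symm⟩
      · obtain ⟨w, hw, c, hc⟩ := ih b hba (hba.trans ha)
        refine ⟨w * g j, mul_mem hw (Subgroup.subset_closure ⟨j, rfl⟩), c, ?_⟩
        rw [pull_mul, ← hc, pull_gen_line hψ hg j (hba.trans ha), hb]
  · rintro ⟨w, hw, b, rfl⟩
    exact pull_mem_planes hψ hg hw _
      (Finset.mem_image_of_mem (fun k => perp (ψ ∘ line k)) (Finset.mem_range.2 (baseIndex_lt b)))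

lemma field_mulVec_of_mem {ω : K} (hω : ω ^ 2 = ω + 1)
    (hg : ∀ j, (g j : Matrix (Fin 3) (Fin 3) K) = gen ω j) {w : GL (Fin 3) K}
    (hw : w ∈ Subgroup.closure (Set.range g)) (i : Fin 3) : ∀ x : Fin 3 → K,
      field ω i ((w : Matrix (Fin 3) (Fin 3) K) *ᵥ x) =
        (w : Matrix (Fin 3) (Fin 3) K) *ᵥ field ω i x := by
  induction hw using Subgroup.closure_induction with
  | mem w hw =>
    obtain ⟨j, rfl⟩ := hw
    intro x
    rw [hg, field_gen_mulVec hω]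
  | one =>
    intro x
    rw [Units.val_one, one_mulVec, one_mulVec]
  | mul w w' _ _ hw hw' =>
    intro x
    rw [Units.val_mul, ← mulVec_mulVec, ← mulVec_mulVec, hw, hw']
  | inv w _ hw =>
    intro x
    have h := hw ((w⁻¹ : GL (Fin 3) K).val *ᵥ x)
    rw [mulVec_mulVec, Units.mul_inv, one_mulVec] at h
    rw [h, mulVec_mulVec, Units.inv_mul, one_mulVec]

end Orbit

section Main

variable {K : Type*} [Field K] {ζ : K}

lemma quartic_eq_zero (hζ : IsPrimitiveRoot ζ 5) : ζ ^ 4 + ζ ^ 3 + ζ ^ 2 + ζ + 1 = 0 := by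
  have h := hζ.geom_sum_eq_zero (by norm_num)
  simp only [Finset.sum_range_succ, Finset.sum_range_zero] at h
  linear_combination h

lemma omega_sq (h4 : ζ ^ 4 + ζ ^ 3 + ζ ^ 2 + ζ + 1 = 0) :
    (-ζ ^ 2 - ζ ^ 3) ^ 2 = (-ζ ^ 2 - ζ ^ 3) + 1 := by
  linear_combination (ζ ^ 2 + ζ - 1) * h4

variable (h4 : ζ ^ 4 + ζ ^ 3 + ζ ^ 2 + ζ + 1 = 0)

lemma lift_omega : Z5.lift ζ h4 ⟨0, 0, -1, -1⟩ = -ζ ^ 2 - ζ ^ 3 := by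
  rw [Z5.lift_apply]
  push_cast
  ring

lemma map_line_single (i : Fin 3) :
    Z5.lift ζ h4 ∘ line (baseIndex i.castSucc) = Pi.single i 1 := by
  ext j
  fin_cases i <;> fin_cases j <;>
    simp [baseIndex, line, lineData, Z5.lift_apply]

lemma map_line_last : Z5.lift ζ h4 ∘ line (baseIndex (Fin.last 3)) = ![1, -ζ ^ 2, 0] := by
  ext j
  fin_cases j <;> simp [baseIndex, line, lineData, Z5.lift_apply]

lemma line_dotProduct_basePoint (b : Fin 4) : line (baseIndex b) ⬝ᵥ basePoint b = 0 := by
  revert b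
  decide +kernel

lemma red_omega : red ⟨0, 0, -1, -1⟩ = 19 := by
  decide +kernel

lemma field_basePoint_ne_smul (hψ : Function.Injective (Z5.lift ζ h4)) (b : Fin 4) (s : K) :
    field (-ζ ^ 2 - ζ ^ 3) 1 (Z5.lift ζ h4 ∘ basePoint b) ≠ s • (Z5.lift ζ h4 ∘ basePoint b) := by
  intro h
  obtain ⟨j, k, hjk⟩ := field_not_radial b
  have h' (l : Fin 3) : Z5.lift ζ h4 (field ⟨0, 0, -1, -1⟩ 1 (basePoint b) l) =
      s * Z5.lift ζ h4 (basePoint b l) := by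
    rw [map_field, lift_omega, h]
    rfl
  have h0 : basePoint b j * field ⟨0, 0, -1, -1⟩ 1 (basePoint b) k =
      basePoint b k * field ⟨0, 0, -1, -1⟩ 1 (basePoint b) j := by
    apply hψ
    rw [map_mul, map_mul, h', h']
    ring
  have h1 := congrArg red h0
  rw [map_mul, map_mul, map_field, map_field, red_omega] at h1
  exact hjk h1

lemma map_det_field {R S : Type*} [CommRing R] [CommRing S] (f : R →+* S) (ω : R) :
    f (Matrix.of fun i => field ω i ![1, 1, 1]).det =
      (Matrix.of fun i => field (f ω) i ![1, 1, 1]).det := by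
  have h1 : f ∘ ![1, 1, 1] = ![1, 1, 1] := by
    ext i
    fin_cases i <;> simp
  rw [RingHom.map_det]
  congr 1
  ext i j
  rw [RingHom.mapMatrix_apply, Matrix.map_apply, Matrix.of_apply, map_field, h1, Matrix.of_apply]

lemma det_field_ne_zero (hψ : Function.Injective (Z5.lift ζ h4)) :
    (Matrix.of fun i => field (-ζ ^ 2 - ζ ^ 3) i ![1, 1, 1]).det ≠ 0 := by
  rw [← lift_omega h4, ← map_det_field, Ne, map_eq_zero_iff _ hψ]
  intro h
  apply field_det_ne_zero
  rw [← red_omega, ← map_det_field, h, map_zero]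

variable [CharZero K]

lemma dotProduct_field_eq_zero (b : Fin 4) (i : Fin 3) {x : Fin 3 → K}
    (hx : (Z5.lift ζ h4 ∘ line (baseIndex b)) ⬝ᵥ x = 0) :
    (Z5.lift ζ h4 ∘ line (baseIndex b)) ⬝ᵥ field (-ζ ^ 2 - ζ ^ 3) i x = 0 := by
  induction b using Fin.lastCases with
  | last =>
    rw [map_line_last] at hx ⊢
    have hx' : x 0 = ζ ^ 2 * x 1 := by
      simp [dotProduct, Fin.sum_univ_three] at hx
      linear_combination hx
    simp [dotProduct, Fin.sum_univ_three, field_sub_eq_zero h4 hx' i]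
  | cast j =>
    rw [map_line_single, single_dotProduct, one_mul] at hx ⊢
    exact field_apply_eq_zero (omega_sq h4) hx

/-- An arrangement consisting of the planes of the orbits of the coordinate planes and of the plane
`x₀ = ζ² x₁` under the group generated by `g` is free, but not recursively free. -/
lemma isFree_and_not_recursivelyFree (hζ : IsPrimitiveRoot ζ 5) {g : Fin 3 → GL (Fin 3) K}
    (hg : ∀ j, (g j : Matrix (Fin 3) (Fin 3) K) = gen (-ζ ^ 2 - ζ ^ 3) j) {A : Arrangement K 3}
    (hA : ∀ H, H ∈ A.hyperplanes ↔ ∃ w ∈ Subgroup.closure (Set.range g), ∃ b,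
      H = pull w (perp (Z5.lift ζ (quartic_eq_zero hζ) ∘ line (baseIndex b)))) :
    IsFree A ∧ ¬ RecursivelyFree K A := by
  have h4 := quartic_eq_zero hζ
  have hψ := Z5.lift_injective hζ h4
  have hω := omega_sq h4
  have hplanes : A.hyperplanes = planes (Z5.lift ζ h4) := by
    ext H
    rw [hA, mem_planes_iff hψ (by rwa [lift_omega])]
  have hcard : A.hyperplanes.card = 27 := by rw [hplanes, card_planes hψ]
  obtain ⟨Q, hQ⟩ := exists_isDefiningPoly A
  obtain ⟨c, hc⟩ := exists_isSaitoFamily (ω := -ζ ^ 2 - ζ ^ 3) hQ hcard (fun i H hH x hx => by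
    obtain ⟨w, hw, b, rfl⟩ := (hA H).1 hH
    rw [mem_pull, mem_perp] at hx ⊢
    rw [← field_mulVec_of_mem hω hg hw]
    exact dotProduct_field_eq_zero h4 b i hx) (det_field_ne_zero h4 hψ)
  refine ⟨hQ.isFree hc.tangent hc.ne_zero hc.det, hc.not_recursivelyFree hcard
    (fun H hH => ⟨card_traces_le hψ hplanes hH, ?_⟩) fun X H hH hX => le_card_traces hψ hplanes hH hX⟩
  obtain ⟨w, hw, b, rfl⟩ := (hA H).1 hH
  have hmul : (w : Matrix (Fin 3) (Fin 3) K) *ᵥ ((w⁻¹ : GL (Fin 3) K).val *ᵥ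
      (Z5.lift ζ h4 ∘ basePoint b)) = Z5.lift ζ h4 ∘ basePoint b := by
    rw [mulVec_mulVec, Units.mul_inv, one_mulVec]
  refine ⟨(w⁻¹ : GL (Fin 3) K).val *ᵥ (Z5.lift ζ h4 ∘ basePoint b), ?_, fun s hs => ?_⟩
  · rw [mem_pull, mem_perp, hmul, ← RingHom.map_dotProduct, line_dotProduct_basePoint, map_zero]
  · rw [vf_fieldDer] at hs
    have h := congrArg ((w : Matrix (Fin 3) (Fin 3) K) *ᵥ ·) hs
    simp only [← field_mulVec_of_mem hω hg hw, mulVec_smul, hmul] at h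
    exact field_basePoint_ne_smul h4 hψ b s h

end Main

end Arrgt

open Arrgt in
/-- The 27-hyperplane arrangement `𝓐` is free but not recursively free. -/
theorem H3A_free_not_recursivelyFree
    (ζ : ℂ) (hζ : IsPrimitiveRoot ζ 5)
    (g1 g2 g3 : GL (Fin 3) ℂ)
    (hg1 : (g1 : Matrix (Fin 3) (Fin 3) ℂ) = !![1, 0, 0; 0, 1, 1; 0, 0, -1])
    (hg2 : (g2 : Matrix (Fin 3) (Fin 3) ℂ) = !![-1, 0, 0; -ζ^2 - ζ^3, 1, 0; 0, 0, 1])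
    (hg3 : (g3 : Matrix (Fin 3) (Fin 3) ℂ) = !![1, -ζ^2 - ζ^3, 0; 0, -1, 0; 0, 1, 1])
    (W : Subgroup (GL (Fin 3) ℂ)) (hW : W = Subgroup.closure {g1, g2, g3})
    (R : Set (Fin 3 → ℂ))
    (hR : R = {w | ∃ g ∈ W, ∃ i : Fin 3,
          w = Matrix.vecMul (Pi.single i 1) (g : Matrix (Fin 3) (Fin 3) ℂ)} ∪
        {w | ∃ g ∈ W, w = Matrix.vecMul ![1, -ζ^2, 0] (g : Matrix (Fin 3) (Fin 3) ℂ)})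
    (𝓐 : Set (Submodule ℂ (Fin 3 → ℂ))) (h𝓐 : 𝓐 = Arrgt.perp '' R)
    (CA : Arrangement ℂ 3) (hCA : ↑CA.hyperplanes = 𝓐) :
    IsFree CA ∧ ¬ RecursivelyFree ℂ CA := by
  have hg : ∀ j, ((![g1, g2, g3] j : GL (Fin 3) ℂ) : Matrix (Fin 3) (Fin 3) ℂ) =
      gen (-ζ ^ 2 - ζ ^ 3) j := by
    intro j
    fin_cases j
    exacts [hg1, hg2, hg3]
  have hrange : Set.range ![g1, g2, g3] = {g1, g2, g3} := by
    simp only [Matrix.range_cons, Matrix.range_empty, Set.union_empty]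
    rfl
  refine isFree_and_not_recursivelyFree hζ hg fun H => ?_
  rw [← Finset.mem_coe, hCA, h𝓐, hR, hrange, ← hW]
  constructor
  · rintro ⟨_, ⟨w, hw, i, rfl⟩ | ⟨w, hw, rfl⟩, rfl⟩
    · exact ⟨w, hw, i.castSucc, by rw [pull_perp, map_line_single]⟩
    · exact ⟨w, hw, Fin.last 3, by rw [pull_perp, map_line_last]⟩
  · rintro ⟨w, hw, b, rfl⟩
    rw [pull_perp]
    refine ⟨_, ?_, rfl⟩
    induction b using Fin.lastCases with
    | last => exact .inr ⟨w, hw, by rw [map_line_last]⟩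
    | cast i => exact .inl ⟨w, hw, i, by rw [map_line_single]⟩
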